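/- For n = 4, the ideals I_3 and Q_3 are algebraically linked via the complete intersection P_3: in S = K[X] one has Q_3 = P_3 :_S I_3 and I_3 = P_3 :_S Q_3, where ':' denotes the ideal colon (quotient). -/

import Mathlib

open Matrix

/-- The generic `n × n` matrix whose entries are the variables `x i j` of the
polynomial ring `K[X]`. -/
noncomputable def genMat (K : Type*) [Field K] (n : ℕ) :
    Matrix (Fin n) (Fin n) (MvPolynomial (Fin n × Fin n) K) :=
  fun i j => MvPolynomial.X (i, j)

/-- `P_t`: the ideal generated by the principal `t`-minors of the generic matrix,
i.e. the determinants of the submatrices whose rows and columns are both indexed by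
a subset `s` of cardinality `t`. -/
noncomputable def prinMinorIdeal (K : Type*) [Field K] (n t : ℕ) :
    Ideal (MvPolynomial (Fin n × Fin n) K) :=
  Ideal.span {p | ∃ s : Finset (Fin n), s.card = t ∧
    p = ((genMat K n).submatrix (fun i : {x // x ∈ s} => (i : Fin n))
        (fun j : {x // x ∈ s} => (j : Fin n))).det}

/-- `I_t`: the determinantal ideal generated by all `t × t` minors of the generic
matrix. -/
noncomputable def detIdeal (K : Type*) [Field K] (n t : ℕ) :
    Ideal (MvPolynomial (Fin n × Fin n) K) :=
  Ideal.span {p | ∃ (I J : Finset (Fin n)) (hI : I.card = t) (hJ : J.card = t),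
    p = (Matrix.of fun a b : Fin t =>
        genMat K n (I.orderIsoOfFin hI a) (J.orderIsoOfFin hJ b)).det}

/-- `Q_{n-1}`: the contraction to `S = K[X]` of the extension of `P_{n-1}` to the
localization `S_Δ = S[1/Δ]`, where `Δ = det X`. -/
noncomputable def Qideal (K : Type*) [Field K] (n : ℕ) :
    Ideal (MvPolynomial (Fin n × Fin n) K) :=
  Ideal.comap (algebraMap (MvPolynomial (Fin n × Fin n) K)
      (Localization.Away (genMat K n).det))
    (Ideal.map (algebraMap (MvPolynomial (Fin n × Fin n) K)
      (Localization.Away (genMat K n).det)) (prinMinorIdeal K n (n - 1)))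

open MvPolynomial in
/-- `p` does not involve the variables in `s`. -/
def FreeOf {σ K : Type*} [CommRing K] (s : σ → Prop) [DecidablePred s] (p : MvPolynomial σ K) : Prop :=
  aeval (fun j => if s j then (0 : MvPolynomial σ K) else X j) p = p

section
open MvPolynomial
universe u v
variable {σ : Type u} {K : Type v} [Field K]

section free
variable {s : σ → Prop} [DecidablePred s] {p q : MvPolynomial σ K}

theorem FreeOf.C (a : K) : FreeOf s (C a : MvPolynomial σ K) := by simp [FreeOf]
theorem FreeOf.zero : FreeOf s (0 : MvPolynomial σ K) := by simp [FreeOf]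
theorem FreeOf.X {j : σ} (h : ¬ s j) : FreeOf s (X j : MvPolynomial σ K) := by simp [FreeOf, h]
theorem FreeOf.add (hp : FreeOf s p) (hq : FreeOf s q) : FreeOf s (p + q) := by
  unfold FreeOf at *; rw [map_add, hp, hq]
theorem FreeOf.neg (hp : FreeOf s p) : FreeOf s (-p) := by
  unfold FreeOf at *; rw [map_neg, hp]
theorem FreeOf.sub (hp : FreeOf s p) (hq : FreeOf s q) : FreeOf s (p - q) := by
  unfold FreeOf at *; rw [map_sub, hp, hq]
theorem FreeOf.mul (hp : FreeOf s p) (hq : FreeOf s q) : FreeOf s (p * q) := by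
  unfold FreeOf at *; rw [map_mul, hp, hq]
theorem FreeOf.pow (hp : FreeOf s p) (n : ℕ) : FreeOf s (p ^ n) := by
  unfold FreeOf at *; rw [map_pow, hp]

theorem freeOf_aeval (p : MvPolynomial σ K) :
    FreeOf s (aeval (fun j => if s j then (0 : MvPolynomial σ K) else MvPolynomial.X j) p) := by
  induction p using MvPolynomial.induction_on with
  | C a => simpa using FreeOf.C a
  | add p q hp hq => rw [map_add]; exact hp.add hq
  | mul_X p j hp =>
    rw [map_mul, aeval_X]
    refine hp.mul ?_
    split_ifs with h
    · exact FreeOf.zero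
    · exact FreeOf.X h

/-- Two algebra maps agreeing on the variables outside `s` agree on the polynomials free of `s`. -/
theorem FreeOf.hom_congr {A : Type*} [CommRing A] [Algebra K A]
    {φ ψ : MvPolynomial σ K →ₐ[K] A} (h : ∀ j, ¬ s j → φ (MvPolynomial.X j) = ψ (MvPolynomial.X j))
    (hp : FreeOf s p) : φ p = ψ p := by
  set τ : MvPolynomial σ K →ₐ[K] MvPolynomial σ K :=
    aeval (fun j => if s j then (0 : MvPolynomial σ K) else MvPolynomial.X j) with hτ
  have : φ.comp τ = ψ.comp τ := by
    ext j
    simp only [AlgHom.comp_apply, hτ, aeval_X]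
    split_ifs with hj
    · simp
    · exact h j hj
  have hp' : τ p = p := hp
  rw [← hp']
  exact DFunLike.congr_fun this p

/-- The substitution killing `s` preserves an ideal generated by polynomials free of `s`. -/
theorem aeval_mem_ofList {l : List (MvPolynomial σ K)} (hl : ∀ p ∈ l, FreeOf s p)
    (hp : p ∈ Ideal.ofList l) :
    aeval (fun j => if s j then (0 : MvPolynomial σ K) else MvPolynomial.X j) p ∈ Ideal.ofList l := by
  have : Ideal.ofList l ≤ (Ideal.ofList l).comap
      (aeval (fun j => if s j then (0 : MvPolynomial σ K) else MvPolynomial.X j)) := by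
    refine Ideal.span_le.2 fun q hq => ?_
    have h := hl q hq
    unfold FreeOf at h
    simp only [Ideal.coe_comap, Set.mem_preimage, SetLike.mem_coe, h]
    exact Ideal.subset_span hq
  exact this hp
end free

variable [DecidableEq σ]

/-- Expansion of a polynomial in powers of one variable. -/
theorem exists_expansion (x : σ) (g : MvPolynomial σ K) :
    ∃ (d : ℕ) (c : ℕ → MvPolynomial σ K), (∀ i, FreeOf (· = x) (c i)) ∧
      g = ∑ i ∈ Finset.range (d + 1), X x ^ i * c i := by
  have ext : ∀ (d e : ℕ) (c : ℕ → MvPolynomial σ K),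
      (∀ i, FreeOf (· = x) (c i)) → ∃ c' : ℕ → MvPolynomial σ K, (∀ i, FreeOf (· = x) (c' i)) ∧
      ∑ i ∈ Finset.range (d + 1), X x ^ i * c i = 
        ∑ i ∈ Finset.range (d + e + 1), X x ^ i * c' i := by
    intro d e c hc
    refine ⟨fun i => if i < d + 1 then c i else 0, fun i => ?_, ?_⟩
    · dsimp only; split_ifs
      exacts [hc i, FreeOf.zero]
    · rw [← Finset.sum_subset (Finset.range_subset_range.2 (by omega : d + 1 ≤ d + e + 1))]
      · refine Finset.sum_congr rfl fun i hi => ?_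
        simp only [if_pos (Finset.mem_range.1 hi)]
      · intro i _ hi
        simp only [if_neg (mt Finset.mem_range.2 hi), mul_zero]
  induction g using MvPolynomial.induction_on with
  | C a => exact ⟨0, fun _ => C a, fun _ => FreeOf.C a, by simp⟩
  | add p q hp hq =>
    obtain ⟨d, c, hc, rfl⟩ := hp
    obtain ⟨e, b, hb, rfl⟩ := hq
    obtain ⟨c', hc', h1⟩ := ext d e c hc
    obtain ⟨b', hb', h2⟩ := ext e d b hb
    refine ⟨d + e, fun i => c' i + b' i, fun i => (hc' i).add (hb' i), ?_⟩
    rw [h1, h2, add_comm e d, ← Finset.sum_add_distrib]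
    simp only [mul_add]
  | mul_X p j hp =>
    obtain ⟨d, c, hc, rfl⟩ := hp
    by_cases hj : j = x
    · subst hj
      refine ⟨d + 1, fun i => match i with | 0 => 0 | i + 1 => c i, fun i => ?_, ?_⟩
      · rcases i with _ | i
        exacts [FreeOf.zero, hc i]
      · rw [Finset.sum_range_succ' _ (d + 1), Finset.sum_mul]
        simp only [mul_zero, add_zero]
        exact Finset.sum_congr rfl fun i _ => by ring
    · refine ⟨d, fun i => c i * X j, fun i => (hc i).mul (FreeOf.X hj), ?_⟩
      rw [Finset.sum_mul]
      exact Finset.sum_congr rfl fun i _ => by ring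

omit [DecidableEq σ] in
/-- A prime ideal is the kernel of an algebra map to a field. -/
theorem exists_algHom_field {N : Ideal (MvPolynomial σ K)} (hN : N.IsPrime) :
    ∃ (F : Type (max u v)) (_ : Field F) (_ : Algebra K F) (χ : MvPolynomial σ K →ₐ[K] F),
      ∀ p, χ p = 0 ↔ p ∈ N := by
  refine ⟨FractionRing (MvPolynomial σ K ⧸ N), inferInstance, inferInstance,
    (IsScalarTower.toAlgHom K (MvPolynomial σ K ⧸ N) _).comp (Ideal.Quotient.mkₐ K N), fun p => ?_⟩
  rw [← Ideal.Quotient.eq_zero_iff_mem]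
  exact map_eq_zero_iff _ (IsFractionRing.injective (MvPolynomial σ K ⧸ N) _)

/-- A family of polynomials linear in one variable `x`, over a prime ideal free of `x`, generates
a prime ideal as soon as it has the expected rank and the constant term of one member is regular
modulo the ideal of leading coefficients. -/
theorem isPrime_append_linear (x : σ) {l : List (MvPolynomial σ K)}
    {m : List (MvPolynomial σ K × MvPolynomial σ K)} {q r : MvPolynomial σ K}
    (hN : (Ideal.ofList l).IsPrime) (hl : ∀ p ∈ l, FreeOf (· = x) p)
    (hm : ∀ p ∈ m, FreeOf (· = x) p.1 ∧ FreeOf (· = x) p.2)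
    (hqr : (q, r) ∈ m) (hq : q ∉ Ideal.ofList l)
    (hrel : ∀ p ∈ m, q * p.2 - p.1 * r ∈ Ideal.ofList l)
    (hC : ∀ t, r * t ∈ Ideal.ofList (l ++ m.map Prod.fst) → t ∈ Ideal.ofList (l ++ m.map Prod.fst)) :
    (Ideal.ofList (l ++ m.map fun p => X x * p.1 + p.2)).IsPrime := by
  set I := Ideal.ofList (l ++ m.map fun p => X x * p.1 + p.2) with hI
  obtain ⟨F, _, _, χ, hχ⟩ := exists_algHom_field hN
  have hq0 : χ q ≠ 0 := mt (hχ q).1 hq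
  let φ : MvPolynomial σ K →ₐ[K] F := aeval fun j => if j = x then -χ r / χ q else χ (X j)
  have hφx : φ (X x) = -χ r / χ q := by simp [φ]
  have hφ : ∀ {p}, FreeOf (· = x) p → φ p = χ p := fun hp =>
    FreeOf.hom_congr (fun j hj => by simp [φ, hj]) hp
  have hlI : Ideal.ofList l ≤ I := by rw [hI, Ideal.ofList_append]; exact le_sup_left
  have hmI : ∀ p ∈ m, X x * p.1 + p.2 ∈ I := fun p hp =>
    Ideal.subset_span (List.mem_append_right _ (List.mem_map_of_mem hp))
  have hIφ : I ≤ RingHom.ker φ := by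
    refine Ideal.span_le.2 fun p hp => ?_
    rcases List.mem_append.1 hp with hp | hp
    · exact (hφ (hl p hp)).trans ((hχ p).2 (Ideal.subset_span hp))
    · obtain ⟨a, ha, rfl⟩ := List.mem_map.1 hp
      have h := (hχ _).2 (hrel a ha)
      rw [map_sub, map_mul, map_mul] at h
      change φ _ = 0
      rw [map_add, map_mul, hφx, hφ (hm a ha).1, hφ (hm a ha).2]
      field_simp
      linear_combination h
  have lift : ∀ c ∈ Ideal.ofList (l ++ m.map Prod.fst), ∃ θ, FreeOf (· = x) θ ∧
      X x * aeval (fun j => if j = x then (0 : MvPolynomial σ K) else X j) c - θ ∈ I := by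
    intro c hc
    induction hc using Submodule.span_induction with
    | mem p hp =>
      rcases List.mem_append.1 hp with hp | hp
      · refine ⟨0, FreeOf.zero, ?_⟩
        rw [show aeval _ p = p from hl p hp, sub_zero]
        exact I.mul_mem_left _ (hlI (Ideal.subset_span hp))
      · obtain ⟨a, ha, rfl⟩ := List.mem_map.1 hp
        refine ⟨-a.2, (hm a ha).2.neg, ?_⟩
        rw [show aeval _ a.1 = a.1 from (hm a ha).1, sub_neg_eq_add]
        exact hmI a ha
    | zero => exact ⟨0, FreeOf.zero, by simp⟩
    | add p p' _ _ h h' =>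
      obtain ⟨θ, h1, h2⟩ := h
      obtain ⟨θ', h1', h2'⟩ := h'
      refine ⟨θ + θ', h1.add h1', ?_⟩
      rw [map_add, mul_add, add_sub_add_comm]
      exact I.add_mem h2 h2'
    | smul a p _ h =>
      obtain ⟨θ, h1, h2⟩ := h
      refine ⟨_, (freeOf_aeval a).mul h1, ?_⟩
      rw [smul_eq_mul, map_mul, mul_left_comm, ← mul_sub]
      exact I.mul_mem_left _ h2
  have key : ∀ (d : ℕ) (c : ℕ → MvPolynomial σ K), (∀ i, FreeOf (· = x) (c i)) →
      φ (∑ i ∈ Finset.range (d + 1), X x ^ i * c i) = 0 →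
      ∑ i ∈ Finset.range (d + 1), X x ^ i * c i ∈ I := by
    intro d
    induction d with
    | zero =>
      intro c hc h
      simp only [zero_add, Finset.range_one, Finset.sum_singleton, pow_zero, one_mul] at h ⊢
      exact hlI ((hχ _).1 ((hφ (hc 0)).symm.trans h))
    | succ d ih =>
      intro c hc h
      have h1 : ∑ i ∈ Finset.range (d + 2), (-r) ^ i * q ^ (d + 1 - i) * c i ∈ Ideal.ofList l := by
        rw [← hχ, map_sum]
        have h2 : χ q ^ (d + 1) * φ (∑ i ∈ Finset.range (d + 2), X x ^ i * c i) = 0 := by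
          rw [h, mul_zero]
        rw [← h2, map_sum, Finset.mul_sum]
        refine Finset.sum_congr rfl fun i hi => ?_
        have hi' : d + 1 = (d + 1 - i) + i := by have := Finset.mem_range.1 hi; omega
        rw [map_mul, map_mul, map_mul, map_pow, map_pow, map_pow, hφx, hφ (hc i), map_neg, div_pow]
        conv_rhs => rw [hi', pow_add]
        field_simp
      have h3 : c (d + 1) ∈ Ideal.ofList (l ++ m.map Prod.fst) := by
        have h4 : r ^ (d + 1) * c (d + 1) ∈ Ideal.ofList (l ++ m.map Prod.fst) := by
          rw [Finset.sum_range_succ] at h1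
          have hq' : q ∈ Ideal.ofList (l ++ m.map Prod.fst) :=
            Ideal.subset_span (List.mem_append_right _ (List.mem_map_of_mem (f := Prod.fst) hqr))
          have h5 : ∑ i ∈ Finset.range (d + 1), (-r) ^ i * q ^ (d + 1 - i) * c i ∈
              Ideal.ofList (l ++ m.map Prod.fst) := by
            refine Ideal.sum_mem _ fun i hi => Ideal.mul_mem_right _ _ (Ideal.mul_mem_left _ _ ?_)
            exact Ideal.pow_mem_of_mem _ hq' _ (by have := Finset.mem_range.1 hi; omega)
          have h6 : Ideal.ofList l ≤ Ideal.ofList (l ++ m.map Prod.fst) := by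
            rw [Ideal.ofList_append]; exact le_sup_left
          have h7 := (Ideal.add_mem_iff_right _ h5).1 (h6 h1)
          rw [Nat.sub_self, pow_zero, mul_one, neg_pow, mul_assoc] at h7
          have h8 := Ideal.mul_mem_left _ ((-1) ^ (d + 1)) h7
          rwa [← mul_assoc, ← mul_pow, neg_one_mul, neg_neg, one_pow, one_mul] at h8
        have h9 : ∀ n, r ^ n * c (d + 1) ∈ Ideal.ofList (l ++ m.map Prod.fst) →
            c (d + 1) ∈ Ideal.ofList (l ++ m.map Prod.fst) := by
          intro n
          induction n with
          | zero => intro h; simpa using h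
          | succ n ihn => intro h; rw [pow_succ', mul_assoc] at h; exact ihn (hC _ h)
        exact h9 _ h4
      obtain ⟨θ, hθ, hθ'⟩ := lift _ h3
      rw [show aeval _ (c (d + 1)) = c (d + 1) from hc (d + 1)] at hθ'
      have h10 : ∑ i ∈ Finset.range (d + 1 + 1), X x ^ i * c i -
          ∑ i ∈ Finset.range (d + 1), X x ^ i * (if i = d then c d + θ else c i) ∈ I := by
        rw [Finset.sum_range_succ, Finset.sum_range_succ, Finset.sum_range_succ]
        rw [if_pos rfl, Finset.sum_congr rfl (g := fun i => X x ^ i * c i)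
          (fun i hi => by rw [if_neg (Finset.mem_range.1 hi).ne] :
            ∀ i ∈ Finset.range d, X x ^ i * (if i = d then c d + θ else c i) = X x ^ i * c i)]
        convert I.mul_mem_left (X x ^ d) hθ' using 1
        ring
      have h11 := ih (fun i => if i = d then c d + θ else c i)
        (fun i => by split_ifs; exacts [(hc d).add hθ, hc i]) (by
          have := hIφ h10
          rw [RingHom.mem_ker, map_sub, h, zero_sub, neg_eq_zero] at this
          exact this)
      simpa using I.add_mem h10 h11
  have : I = RingHom.ker φ := by
    refine le_antisymm hIφ fun g hg => ?_
    obtain ⟨d, c, hc, rfl⟩ := exists_expansion x g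
    exact key d c hc hg
  rw [this]
  exact RingHom.ker_isPrime _

omit [DecidableEq σ] in
theorem FreeOf.mono {s t : σ → Prop} [DecidablePred s] [DecidablePred t] {p : MvPolynomial σ K}
    (h : ∀ j, t j → s j) (hp : FreeOf s p) : FreeOf t p := by
  have := FreeOf.hom_congr (φ := aeval fun j => if t j then (0 : MvPolynomial σ K) else MvPolynomial.X j)
    (ψ := AlgHom.id K _) (fun j hj => by simp [mt (h j) hj]) hp
  exact this

omit [DecidableEq σ] in
theorem isPrime_ofList_nil : (Ideal.ofList ([] : List (MvPolynomial σ K))).IsPrime := by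
  rw [Ideal.ofList_nil]; exact Ideal.isPrime_bot

section comm
variable {R : Type*} [CommRing R]

theorem Ideal.mem_ofList_of_mem {l : List R} {p : R} (h : p ∈ l) : p ∈ Ideal.ofList l :=
  Ideal.subset_span h

theorem Ideal.ofList_le {l : List R} {I : Ideal R} (h : ∀ p ∈ l, p ∈ I) : Ideal.ofList l ≤ I :=
  Ideal.span_le.2 h

theorem Ideal.mem_ofList_cons {l : List R} {a p : R} :
    p ∈ Ideal.ofList (a :: l) ↔ ∃ c, p - c * a ∈ Ideal.ofList l := by
  rw [Ideal.ofList_cons, Submodule.mem_sup]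
  constructor
  · rintro ⟨y, hy, z, hz, rfl⟩
    obtain ⟨c, rfl⟩ := Ideal.mem_span_singleton'.1 hy
    exact ⟨c, by simpa using hz⟩
  · rintro ⟨c, h⟩
    exact ⟨c * a, Ideal.mem_span_singleton'.2 ⟨c, rfl⟩, _, h, by ring⟩

theorem Ideal.IsPrime.ofList_congr {l l' : List R} (h : (Ideal.ofList l).IsPrime)
    (h1 : ∀ p ∈ l, p ∈ Ideal.ofList l') (h2 : ∀ p ∈ l', p ∈ Ideal.ofList l) :
    (Ideal.ofList l').IsPrime := by
  rwa [le_antisymm (Ideal.ofList_le h2) (Ideal.ofList_le h1)]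

theorem Ideal.IsPrime.ofList_perm {l l' : List R} (h : (Ideal.ofList l).IsPrime)
    (hl : l.Perm l') : (Ideal.ofList l').IsPrime :=
  h.ofList_congr (fun _ hp => Ideal.mem_ofList_of_mem (hl.mem_iff.1 hp))
    fun _ hp => Ideal.mem_ofList_of_mem (hl.mem_iff.2 hp)

/-- `r` is regular modulo the ideal `I`. -/
def RegularMod (r : R) (I : Ideal R) : Prop := ∀ t, r * t ∈ I → t ∈ I

theorem Ideal.IsPrime.regularMod {r : R} {I : Ideal R} (h : I.IsPrime) (hr : r ∉ I) :
    RegularMod r I := fun _ ht => (h.mem_or_mem ht).resolve_left hr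

theorem RegularMod.mul_left {r a b : R} {l : List R} (hal : RegularMod a (Ideal.ofList l))
    (ha : RegularMod r (Ideal.ofList (a :: l))) (hb : RegularMod r (Ideal.ofList (b :: l))) :
    RegularMod r (Ideal.ofList (a * b :: l)) := by
  intro t ht
  rw [Ideal.mem_ofList_cons] at ht
  obtain ⟨c, hc⟩ := ht
  obtain ⟨e, he⟩ := Ideal.mem_ofList_cons.1 (ha t (Ideal.mem_ofList_cons.2
    ⟨c * b, by rwa [mul_assoc, mul_comm b a]⟩))
  have h : a * (r * e - c * b) ∈ Ideal.ofList l := by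
    have := (Ideal.ofList l).sub_mem hc ((Ideal.ofList l).mul_mem_left r he)
    convert this using 1
    ring
  obtain ⟨f, hf⟩ := Ideal.mem_ofList_cons.1 (hb e (Ideal.mem_ofList_cons.2 ⟨c, hal _ h⟩))
  refine Ideal.mem_ofList_cons.2 ⟨f, ?_⟩
  have := (Ideal.ofList l).add_mem he ((Ideal.ofList l).mul_mem_left a hf)
  convert this using 1
  ring

theorem Ideal.not_mem_ofList_of_hom {A : Type*} [CommRing A] (φ : R →+* A) {l : List R} {r : R}
    (h : ∀ p ∈ l, φ p = 0) (hr : φ r ≠ 0) : r ∉ Ideal.ofList l := fun hm =>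
  hr ((Ideal.ofList_le (I := RingHom.ker φ) h) hm)

/-- The saturation of `I` with respect to the powers of `z`. -/
def satIdeal (z : R) (I : Ideal R) : Ideal R where
  carrier := {g | ∃ n : ℕ, z ^ n * g ∈ I}
  add_mem' := by
    rintro a b ⟨n, hn⟩ ⟨m, hm⟩
    refine ⟨n + m, ?_⟩
    rw [show z ^ (n + m) * (a + b) = z ^ m * (z ^ n * a) + z ^ n * (z ^ m * b) by ring]
    exact I.add_mem (I.mul_mem_left _ hn) (I.mul_mem_left _ hm)
  zero_mem' := ⟨0, by simp⟩
  smul_mem' := by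
    rintro c a ⟨n, hn⟩
    refine ⟨n, ?_⟩
    rw [smul_eq_mul, mul_left_comm]
    exact I.mul_mem_left _ hn

theorem le_satIdeal (z : R) (I : Ideal R) : I ≤ satIdeal z I := fun g hg => ⟨0, by simpa using hg⟩

theorem mem_satIdeal_of_mul {z g : R} {I : Ideal R} (h : z * g ∈ satIdeal z I) :
    g ∈ satIdeal z I := by
  obtain ⟨n, hn⟩ := h
  exact ⟨n + 1, by rwa [pow_succ, mul_assoc]⟩

theorem mem_satIdeal_of_mul_left {y z g : R} {I : Ideal R} (h : y * g ∈ satIdeal (y * z) I) :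
    g ∈ satIdeal (y * z) I :=
  mem_satIdeal_of_mul (by rw [mul_comm y z, mul_assoc, mul_comm z y]; exact Ideal.mul_mem_left _ _ h)

theorem mem_satIdeal_of_mul_right {y z g : R} {I : Ideal R} (h : z * g ∈ satIdeal (y * z) I) :
    g ∈ satIdeal (y * z) I :=
  mem_satIdeal_of_mul (by rw [mul_assoc]; exact Ideal.mul_mem_left _ _ h)

end comm

/-- `x q + r` generates a prime ideal over a prime ideal free of `x`. -/
theorem isPrime_cons_linear (x : σ) {l : List (MvPolynomial σ K)} {q r : MvPolynomial σ K}
    (hN : (Ideal.ofList l).IsPrime) (hl : ∀ p ∈ l, FreeOf (· = x) p) (hqx : FreeOf (· = x) q)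
    (hrx : FreeOf (· = x) r) (hq : q ∉ Ideal.ofList l) (hC : RegularMod r (Ideal.ofList (q :: l))) :
    (Ideal.ofList ((X x * q + r) :: l)).IsPrime := by
  have h := isPrime_append_linear x (m := [(q, r)]) hN hl (by simp [hqx, hrx])
    (List.mem_singleton_self _) hq (by simp [mul_comm])
    (by
      have : Ideal.ofList (l ++ [q]) = Ideal.ofList (q :: l) := by
        rw [Ideal.ofList_append, Ideal.ofList_singleton, Ideal.ofList_cons, sup_comm]
      simpa [this, RegularMod] using hC)
  exact h.ofList_perm (List.perm_append_singleton _ _)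

theorem isPrime_cons_var (x : σ) {l : List (MvPolynomial σ K)}
    (hN : (Ideal.ofList l).IsPrime) (hl : ∀ p ∈ l, FreeOf (· = x) p) :
    (Ideal.ofList (X x :: l)).IsPrime := by
  have h := isPrime_cons_linear x (q := 1) (r := 0) hN hl (by simp [FreeOf]) FreeOf.zero
    (fun h => hN.ne_top ((Ideal.eq_top_iff_one _).2 h)) (fun t _ => by
      rw [(Ideal.eq_top_iff_one _).2 (Ideal.mem_ofList_of_mem (List.mem_cons_self ..))]; trivial)
  simpa using h

/-- `x y + r` generates a prime ideal over a prime ideal free of both `x` and `y`. -/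
theorem isPrime_cons_mul (x y : σ) (hxy : x ≠ y) {l : List (MvPolynomial σ K)}
    {r : MvPolynomial σ K} (hN : (Ideal.ofList l).IsPrime)
    (hl : ∀ p ∈ l, FreeOf (fun j => j = x ∨ j = y) p) (hrx : FreeOf (fun j => j = x ∨ j = y) r)
    (hr : r ∉ Ideal.ofList l) :
    (Ideal.ofList ((X x * X y + r) :: l)).IsPrime := by
  have hly : ∀ p ∈ l, FreeOf (· = y) p := fun p hp => (hl p hp).mono fun _ => Or.inr
  have hry : FreeOf (· = y) r := hrx.mono fun _ => Or.inr
  refine isPrime_cons_linear x hN (fun p hp => (hl p hp).mono fun _ => Or.inl)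
    (FreeOf.X fun h => hxy h.symm) (hrx.mono fun _ => Or.inl) (fun h => ?_)
    ((isPrime_cons_var y hN hly).regularMod fun h => ?_)
  · obtain ⟨F, _, _, χ, hχ⟩ := exists_algHom_field hN
    refine Ideal.not_mem_ofList_of_hom
      (aeval (fun j => if j = y then 1 else χ (X j)) : MvPolynomial σ K →ₐ[K] F).toRingHom
      (fun p hp => ?_) (by simp) h
    refine (FreeOf.hom_congr (fun j hj => by simp [hj]) (hly p hp)).trans
      ((hχ p).2 (Ideal.mem_ofList_of_mem hp))
  · obtain ⟨c, hc⟩ := Ideal.mem_ofList_cons.1 h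
    have := aeval_mem_ofList hly hc
    rw [map_sub, map_mul, aeval_X, if_pos rfl, mul_zero, sub_zero,
      show aeval _ r = r from hry] at this
    exact hr this

omit [DecidableEq σ] in
/-- If every variable in `s` is, up to powers of `z`, congruent modulo `J` to a polynomial free of
`s`, then so is every polynomial. -/
theorem exists_free_congr {s : σ → Prop} [DecidablePred s] {J : Ideal (MvPolynomial σ K)}
    {z : MvPolynomial σ K} (hz : FreeOf s z)
    (hs : ∀ j, s j → ∃ (n : ℕ) (c : MvPolynomial σ K), FreeOf s c ∧ z ^ n * X j - c ∈ J)
    (g : MvPolynomial σ K) : ∃ (n : ℕ) (c : MvPolynomial σ K), FreeOf s c ∧ z ^ n * g - c ∈ J := by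
  induction g using MvPolynomial.induction_on with
  | C a => exact ⟨0, C a, FreeOf.C a, by simp⟩
  | add p q hp hq =>
    obtain ⟨n, c, hc, h⟩ := hp
    obtain ⟨m, d, hd, h'⟩ := hq
    refine ⟨n + m, z ^ m * c + z ^ n * d, ((hz.pow m).mul hc).add ((hz.pow n).mul hd), ?_⟩
    convert J.add_mem (J.mul_mem_left (z ^ m) h) (J.mul_mem_left (z ^ n) h') using 1
    ring
  | mul_X p j hp =>
    obtain ⟨n, c, hc, h⟩ := hp
    obtain ⟨m, d, hd, h'⟩ : ∃ (m : ℕ) (d : MvPolynomial σ K), FreeOf s d ∧ z ^ m * X j - d ∈ J := by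
      by_cases hj : s j
      · exact hs j hj
      · exact ⟨0, X j, FreeOf.X hj, by simp⟩
    refine ⟨n + m, c * d, hc.mul hd, ?_⟩
    convert J.add_mem (J.mul_mem_left (z ^ m * X j) h) (J.mul_mem_left c h') using 1
    ring

/-- The exchange step: a multiple of `b` annihilated modulo `J + (p)` by `T` can be traded for an
element annihilated modulo `J + (z)`. -/
theorem exists_exchange {R : Type*} [CommRing R] {J : List R} {T : Set R} {p z b : R}
    (hp : RegularMod p (Ideal.ofList J)) (hz : RegularMod z (Ideal.ofList J)) (hzT : z ∈ T)
    (hb : ∀ t ∈ T, t * b ∈ Ideal.ofList (p :: J)) :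
    ∃ b', (∀ t ∈ T, t * b' ∈ Ideal.ofList (z :: J)) ∧
      ∀ e, e * b' ∈ Ideal.ofList (z :: J) → e * b ∈ Ideal.ofList (p :: J) := by
  obtain ⟨b', hb'⟩ := Ideal.mem_ofList_cons.1 (hb z hzT)
  refine ⟨b', fun t ht => ?_, fun e h => ?_⟩
  · obtain ⟨c, hc⟩ := Ideal.mem_ofList_cons.1 (hb t ht)
    refine Ideal.mem_ofList_cons.2 ⟨c, hp _ ?_⟩
    convert Ideal.sub_mem _ (Ideal.mul_mem_left _ z hc) (Ideal.mul_mem_left _ t hb') using 1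
    ring
  · obtain ⟨c, hc⟩ := Ideal.mem_ofList_cons.1 h
    refine Ideal.mem_ofList_cons.2 ⟨c, hz _ ?_⟩
    convert Ideal.add_mem _ (Ideal.mul_mem_left _ e hb') (Ideal.mul_mem_left _ p hc) using 1
    ring

end

section
open MvPolynomial
universe v
variable {K : Type v} [Field K]

/-- The `2`-minor with rows `a, b` and columns `c, d`. -/
noncomputable def minorTwo (a b c d : Fin 4) : MvPolynomial (Fin 4 × Fin 4) K :=
  X (a, c) * X (b, d) - X (a, d) * X (b, c)

/-- The `3`-minor with rows `a, b, c` and columns `d, e, f`. -/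
noncomputable def minorThree (a b c d e f : Fin 4) : MvPolynomial (Fin 4 × Fin 4) K :=
  X (a, d) * minorTwo b c e f - X (a, e) * minorTwo b c d f + X (a, f) * minorTwo b c d e

theorem not_mem_of_eval (A : Matrix (Fin 4) (Fin 4) K) {l : List (MvPolynomial (Fin 4 × Fin 4) K)}
    {r : MvPolynomial (Fin 4 × Fin 4) K} (h : ∀ p ∈ l, eval (fun ij => A ij.1 ij.2) p = 0)
    (hr : eval (fun ij => A ij.1 ij.2) r ≠ 0) : r ∉ Ideal.ofList l :=
  Ideal.not_mem_ofList_of_hom _ h hr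

theorem isPrime_cons_minor_zero {l : List (MvPolynomial (Fin 4 × Fin 4) K)}
    (h : (Ideal.ofList l).IsPrime) (h' : (Ideal.ofList (minorTwo 2 3 3 1 :: l)).IsPrime)
    (hl : ∀ p ∈ l, FreeOf (· = ((1, 2) : Fin 4 × Fin 4)) p)
    (hq : minorTwo 2 3 3 1 ∉ Ideal.ofList l)
    (hr : X (1, 1) * minorTwo 2 3 2 3 + X (1, 3) * minorTwo 2 3 1 2 ∉
      Ideal.ofList (minorTwo 2 3 3 1 :: l)) :
    (Ideal.ofList (minorThree 1 2 3 1 2 3 :: l)).IsPrime := by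
  have := isPrime_cons_linear (1, 2) h hl (by simp [FreeOf, minorTwo]) (by simp [FreeOf, minorTwo])
    hq (h'.regularMod hr)
  convert this using 3
  simp only [minorThree, minorTwo]; ring

theorem isPrime_cons_minor_one {l : List (MvPolynomial (Fin 4 × Fin 4) K)}
    (h : (Ideal.ofList l).IsPrime) (h' : (Ideal.ofList (minorTwo 0 3 3 2 :: l)).IsPrime)
    (hl : ∀ p ∈ l, FreeOf (· = ((2, 0) : Fin 4 × Fin 4)) p)
    (hq : minorTwo 0 3 3 2 ∉ Ideal.ofList l)
    (hr : X (2, 2) * minorTwo 0 3 0 3 - X (2, 3) * minorTwo 0 3 0 2 ∉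
      Ideal.ofList (minorTwo 0 3 3 2 :: l)) :
    (Ideal.ofList (minorThree 0 2 3 0 2 3 :: l)).IsPrime := by
  have := isPrime_cons_linear (2, 0) h hl (by simp [FreeOf, minorTwo]) (by simp [FreeOf, minorTwo])
    hq (h'.regularMod hr)
  convert this using 3
  simp only [minorThree, minorTwo]; ring

theorem isPrime_cons_minor_two {l : List (MvPolynomial (Fin 4 × Fin 4) K)}
    (h : (Ideal.ofList l).IsPrime) (h' : (Ideal.ofList (minorTwo 1 3 3 0 :: l)).IsPrime)
    (hl : ∀ p ∈ l, FreeOf (· = ((0, 1) : Fin 4 × Fin 4)) p)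
    (hq : minorTwo 1 3 3 0 ∉ Ideal.ofList l)
    (hr : X (0, 0) * minorTwo 1 3 1 3 + X (0, 3) * minorTwo 1 3 0 1 ∉
      Ideal.ofList (minorTwo 1 3 3 0 :: l)) :
    (Ideal.ofList (minorThree 0 1 3 0 1 3 :: l)).IsPrime := by
  have := isPrime_cons_linear (0, 1) h hl (by simp [FreeOf, minorTwo]) (by simp [FreeOf, minorTwo])
    hq (h'.regularMod hr)
  convert this using 3
  simp only [minorThree, minorTwo]; ring

/-- A `2`-minor, with a free product of variables on its diagonal. -/
theorem isPrime_cons_minorTwo {a b c d : Fin 4} {l : List (MvPolynomial (Fin 4 × Fin 4) K)}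
    (h : (Ideal.ofList l).IsPrime) (hab : a ≠ b) (hcd : c ≠ d)
    (hl : ∀ p ∈ l, FreeOf (fun j => j = (a, c) ∨ j = (b, d)) p)
    (hr : X (a, d) * X (b, c) ∉ Ideal.ofList l) :
    (Ideal.ofList (minorTwo a b c d :: l)).IsPrime := by
  rw [minorTwo, sub_eq_add_neg]
  exact isPrime_cons_mul (a, c) (b, d) (by simp [hab]) h hl
    ((FreeOf.X (by simp [hab, hcd.symm])).mul (FreeOf.X (by simp [hab.symm, hcd]))).neg
    (by rwa [neg_mem_iff])

theorem isPrime_coeff_zero :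
    (Ideal.ofList [minorTwo 2 3 3 1] : Ideal (MvPolynomial (Fin 4 × Fin 4) K)).IsPrime := by
  refine isPrime_cons_minorTwo isPrime_ofList_nil (by decide) (by decide) (by simp) ?_
  exact not_mem_of_eval (fun _ _ => 1) (by simp) (by simp)

theorem isPrime_coeff_one :
    (Ideal.ofList [minorTwo 0 3 3 2] : Ideal (MvPolynomial (Fin 4 × Fin 4) K)).IsPrime := by
  refine isPrime_cons_minorTwo isPrime_ofList_nil (by decide) (by decide) (by simp) ?_
  exact not_mem_of_eval (fun _ _ => 1) (by simp) (by simp)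

theorem isPrime_coeff_two :
    (Ideal.ofList [minorTwo 1 3 3 0] : Ideal (MvPolynomial (Fin 4 × Fin 4) K)).IsPrime := by
  refine isPrime_cons_minorTwo isPrime_ofList_nil (by decide) (by decide) (by simp) ?_
  exact not_mem_of_eval (fun _ _ => 1) (by simp) (by simp)

theorem isPrime_coeff_zero_two :
    (Ideal.ofList [minorTwo 2 3 3 1, minorTwo 1 3 3 0] :
      Ideal (MvPolynomial (Fin 4 × Fin 4) K)).IsPrime := by
  refine isPrime_cons_minorTwo isPrime_coeff_two (by decide) (by decide)
    (by simp [FreeOf, minorTwo]) ?_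
  exact not_mem_of_eval !![0, 0, 0, 0; 0, 0, 0, 0; 0, 1, 0, 0; 0, 0, 0, 1] (by simp [minorTwo])
    (by simp)

theorem isPrime_coeff_one_two :
    (Ideal.ofList [minorTwo 0 3 3 2, minorTwo 1 3 3 0] :
      Ideal (MvPolynomial (Fin 4 × Fin 4) K)).IsPrime := by
  refine isPrime_cons_minorTwo isPrime_coeff_two (by decide) (by decide)
    (by simp [FreeOf, minorTwo]) ?_
  exact not_mem_of_eval !![0, 0, 1, 0; 0, 0, 0, 0; 0, 0, 0, 0; 0, 0, 0, 1] (by simp [minorTwo])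
    (by simp)

theorem isPrime_coeff_zero_one :
    (Ideal.ofList [minorTwo 2 3 3 1, minorTwo 0 3 3 2] :
      Ideal (MvPolynomial (Fin 4 × Fin 4) K)).IsPrime := by
  refine isPrime_cons_minorTwo isPrime_coeff_one (by decide) (by decide)
    (by simp [FreeOf, minorTwo]) ?_
  exact not_mem_of_eval !![0, 0, 0, 0; 0, 0, 0, 0; 0, 1, 0, 0; 0, 0, 0, 1] (by simp [minorTwo])
    (by simp)

theorem isPrime_coeff_zero_one_two :
    (Ideal.ofList [minorTwo 2 3 3 1, minorTwo 0 3 3 2, minorTwo 1 3 3 0] :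
      Ideal (MvPolynomial (Fin 4 × Fin 4) K)).IsPrime := by
  refine isPrime_cons_minorTwo isPrime_coeff_one_two (by decide) (by decide)
    (by simp [FreeOf, minorTwo]) ?_
  exact not_mem_of_eval !![0, 0, 0, 0; 0, 0, 0, 0; 0, 1, 0, 0; 0, 0, 0, 1] (by simp [minorTwo])
    (by simp)

theorem isPrime_minor_zero :
    (Ideal.ofList [minorThree 1 2 3 1 2 3] : Ideal (MvPolynomial (Fin 4 × Fin 4) K)).IsPrime :=
  isPrime_cons_minor_zero isPrime_ofList_nil isPrime_coeff_zero (by simp)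
    (not_mem_of_eval !![0, 0, 0, 0; 0, 0, 0, 0; 0, 1, 0, 0; 0, 0, 0, 1] (by simp)
      (by simp [minorTwo]))
    (not_mem_of_eval !![0, 0, 0, 0; 0, 0, 0, 1; 0, 1, 0, 0; 0, 0, 1, 0] (by simp [minorTwo])
      (by simp [minorTwo]))

theorem isPrime_minor_zero_coeff_one :
    (Ideal.ofList [minorThree 1 2 3 1 2 3, minorTwo 0 3 3 2] :
      Ideal (MvPolynomial (Fin 4 × Fin 4) K)).IsPrime :=
  isPrime_cons_minor_zero isPrime_coeff_one isPrime_coeff_zero_one (by simp [FreeOf, minorTwo])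
    (not_mem_of_eval !![0, 0, 0, 0; 0, 0, 0, 0; 0, 1, 0, 0; 0, 0, 0, 1] (by simp [minorTwo])
      (by simp [minorTwo]))
    (not_mem_of_eval !![0, 0, 0, 0; 0, 0, 0, 1; 0, 1, 0, 0; 0, 0, 1, 0] (by simp [minorTwo])
      (by simp [minorTwo]))

theorem isPrime_minor_zero_coeff_two :
    (Ideal.ofList [minorThree 1 2 3 1 2 3, minorTwo 1 3 3 0] :
      Ideal (MvPolynomial (Fin 4 × Fin 4) K)).IsPrime :=
  isPrime_cons_minor_zero isPrime_coeff_two isPrime_coeff_zero_two (by simp [FreeOf, minorTwo])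
    (not_mem_of_eval !![0, 0, 0, 0; 0, 0, 0, 0; 0, 1, 0, 0; 0, 0, 0, 1] (by simp [minorTwo])
      (by simp [minorTwo]))
    (not_mem_of_eval !![0, 0, 0, 0; 0, 0, 0, 1; 0, 1, 0, 0; 0, 0, 1, 0] (by simp [minorTwo])
      (by simp [minorTwo]))

theorem isPrime_minor_zero_coeff_one_two :
    (Ideal.ofList [minorThree 1 2 3 1 2 3, minorTwo 0 3 3 2, minorTwo 1 3 3 0] :
      Ideal (MvPolynomial (Fin 4 × Fin 4) K)).IsPrime :=
  isPrime_cons_minor_zero isPrime_coeff_one_two isPrime_coeff_zero_one_two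
    (by simp [FreeOf, minorTwo])
    (not_mem_of_eval !![0, 0, 0, 0; 0, 0, 0, 0; 0, 1, 0, 0; 0, 0, 0, 1] (by simp [minorTwo])
      (by simp [minorTwo]))
    (not_mem_of_eval !![0, 0, 0, 0; 0, 0, 0, 1; 0, 1, 0, 0; 0, 0, 1, 0] (by simp [minorTwo])
      (by simp [minorTwo]))

theorem isPrime_minor_one_zero :
    (Ideal.ofList [minorThree 0 2 3 0 2 3, minorThree 1 2 3 1 2 3] :
      Ideal (MvPolynomial (Fin 4 × Fin 4) K)).IsPrime :=
  isPrime_cons_minor_one isPrime_minor_zero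
    (isPrime_minor_zero_coeff_one.ofList_perm (List.Perm.swap ..))
    (by simp [FreeOf, minorTwo, minorThree])
    (not_mem_of_eval !![0, 0, 0, 1; 0, 0, 0, 0; 0, 0, 0, 0; 0, 0, 1, 0]
      (by simp [minorTwo, minorThree]) (by simp [minorTwo]))
    (not_mem_of_eval !![0, 0, 0, 1; 0, 0, 0, 0; 0, 0, 1, 0; 1, 0, 0, 1]
      (by simp [minorTwo, minorThree]) (by simp [minorTwo]))

theorem isPrime_minor_one_zero_coeff_two :
    (Ideal.ofList [minorThree 0 2 3 0 2 3, minorThree 1 2 3 1 2 3, minorTwo 1 3 3 0] :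
      Ideal (MvPolynomial (Fin 4 × Fin 4) K)).IsPrime :=
  isPrime_cons_minor_one isPrime_minor_zero_coeff_two
    (isPrime_minor_zero_coeff_one_two.ofList_perm (List.Perm.swap ..))
    (by simp [FreeOf, minorTwo, minorThree])
    (not_mem_of_eval !![0, 0, 0, 1; 0, 0, 0, 0; 0, 0, 0, 0; 0, 0, 1, 0]
      (by simp [minorTwo, minorThree]) (by simp [minorTwo]))
    (not_mem_of_eval !![0, 0, 0, 1; 0, 0, 0, 0; 0, 0, 1, 0; 1, 0, 0, 1]
      (by simp [minorTwo, minorThree]) (by simp [minorTwo]))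

theorem isPrime_minor_two_one_zero :
    (Ideal.ofList [minorThree 0 1 3 0 1 3, minorThree 0 2 3 0 2 3, minorThree 1 2 3 1 2 3] :
      Ideal (MvPolynomial (Fin 4 × Fin 4) K)).IsPrime :=
  isPrime_cons_minor_two isPrime_minor_one_zero
    (isPrime_minor_one_zero_coeff_two.ofList_perm (List.perm_append_comm (l₁ := [_, _]) (l₂ := [_])))
    (by simp [FreeOf, minorTwo, minorThree])
    (not_mem_of_eval !![0, 0, 0, 0; 1, 1, 0, 0; 1, 0, 0, 0; 1, 0, 0, 1]
      (by simp [minorTwo, minorThree]) (by simp [minorTwo]))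
    (not_mem_of_eval !![0, 0, 0, 1; 1, 0, 0, 0; 0, 0, 0, 0; 1, 1, 1, 0]
      (by simp [minorTwo, minorThree]) (by simp [minorTwo]))
end

section
open MvPolynomial
universe v
variable {K : Type v} [Field K]

theorem Ideal.ofList_perm {R : Type*} [CommRing R] {l l' : List R} (h : l.Perm l') :
    Ideal.ofList l = Ideal.ofList l' :=
  le_antisymm (Ideal.ofList_le fun _ hp => Ideal.mem_ofList_of_mem (h.mem_iff.1 hp))
    (Ideal.ofList_le fun _ hp => Ideal.mem_ofList_of_mem (h.mem_iff.2 hp))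

theorem Ideal.ofList_rotate {R : Type*} [CommRing R] (a b c d : R) :
    Ideal.ofList [a, b, c, d] = Ideal.ofList [b, c, d, a] :=
  Ideal.ofList_perm (List.perm_append_comm (l₁ := [_]) (l₂ := [_, _, _]))

theorem isPrime_minorTwo_one_zero :
    (Ideal.ofList [minorTwo 0 1 1 0, minorThree 0 2 3 0 2 3, minorThree 1 2 3 1 2 3] :
      Ideal (MvPolynomial (Fin 4 × Fin 4) K)).IsPrime := by
  refine isPrime_cons_minorTwo isPrime_minor_one_zero (by decide) (by decide)
    (by simp [FreeOf, minorTwo, minorThree]) ?_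
  exact not_mem_of_eval !![1, 0, 0, 1; 0, 1, 1, 0; 0, 0, 0, 0; 0, 0, 0, 0]
    (by simp [minorTwo, minorThree]) (by simp)

theorem isPrime_minorTwo_minorTwo_zero :
    (Ideal.ofList [minorTwo 0 1 1 0, minorTwo 0 2 2 0, minorThree 1 2 3 1 2 3] :
      Ideal (MvPolynomial (Fin 4 × Fin 4) K)).IsPrime := by
  refine isPrime_cons_minorTwo (isPrime_cons_minorTwo isPrime_minor_zero (by decide) (by decide)
    (by simp [FreeOf, minorTwo, minorThree]) ?_) (by decide) (by decide)
    (by simp [FreeOf, minorTwo, minorThree]) ?_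
  · exact not_mem_of_eval !![1, 0, 0, 0; 0, 0, 0, 0; 0, 0, 1, 1; 0, 1, 0, 0]
      (by simp [minorTwo, minorThree]) (by simp)
  · exact not_mem_of_eval !![1, 0, 0, 0; 1, 1, 1, 0; 0, 0, 0, 0; 0, 0, 0, 0]
      (by simp [minorTwo, minorThree]) (by simp)

theorem isPrime_minorTwo_zero :
    (Ideal.ofList [minorTwo 0 1 1 0, minorTwo 0 2 2 0, minorTwo 0 3 3 0] :
      Ideal (MvPolynomial (Fin 4 × Fin 4) K)).IsPrime := by
  refine isPrime_cons_minorTwo (isPrime_cons_minorTwo (isPrime_cons_minorTwo isPrime_ofList_nil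
    (by decide) (by decide) (by simp) ?_) (by decide) (by decide) (by simp [FreeOf, minorTwo]) ?_)
    (by decide) (by decide) (by simp [FreeOf, minorTwo]) ?_
  · exact not_mem_of_eval (fun _ _ => 1) (by simp) (by simp)
  · exact not_mem_of_eval !![1, 1, 0, 1; 0, 0, 0, 0; 0, 1, 1, 0; 0, 0, 0, 0]
      (by simp [minorTwo]) (by simp)
  · exact not_mem_of_eval !![1, 0, 0, 0; 0, 1, 0, 1; 0, 0, 0, 0; 0, 0, 1, 0]
      (by simp [minorTwo]) (by simp)

theorem isPrime_minorTwo_one_minorTwo_zero :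
    (Ideal.ofList [minorTwo 1 2 2 1, minorTwo 0 1 1 0, minorTwo 0 2 2 0, minorTwo 0 3 3 0] :
      Ideal (MvPolynomial (Fin 4 × Fin 4) K)).IsPrime := by
  refine isPrime_cons_minorTwo isPrime_minorTwo_zero (by decide) (by decide)
    (by simp [FreeOf, minorTwo]) ?_
  exact not_mem_of_eval !![0, 0, 0, 1; 0, 1, 0, 0; 1, 0, 1, 0; 0, 0, 0, 0]
    (by simp [minorTwo]) (by simp)

/-- The principal `2`-minors on at most the first three indices together with one more generate an
ideal with no nonzero annihilator modulo the ideal of the principal `3`-minors. -/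
theorem mem_of_forall_minorTwo_mul_mem {b : MvPolynomial (Fin 4 × Fin 4) K}
    (hb : ∀ t ∈ ({minorTwo 0 1 1 0, minorTwo 0 2 2 0, minorTwo 0 3 3 0, minorTwo 1 2 2 1,
      minorTwo 1 3 3 1} : Set (MvPolynomial (Fin 4 × Fin 4) K)), t * b ∈
      Ideal.ofList [minorThree 0 1 2 0 1 2, minorThree 0 1 3 0 1 3, minorThree 0 2 3 0 2 3,
        minorThree 1 2 3 1 2 3]) :
    b ∈ Ideal.ofList [minorThree 0 1 2 0 1 2, minorThree 0 1 3 0 1 3, minorThree 0 2 3 0 2 3,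
      minorThree 1 2 3 1 2 3] := by
  have J1 := isPrime_minor_two_one_zero (K := K)
  have J2 : (Ideal.ofList [minorThree 0 2 3 0 2 3, minorThree 1 2 3 1 2 3,
      minorTwo 0 1 1 0 (K := K)]).IsPrime := (isPrime_minorTwo_one_zero (K := K)).ofList_perm
    (List.perm_append_comm (l₁ := [_]) (l₂ := [_, _]))
  have J3 : (Ideal.ofList [minorThree 1 2 3 1 2 3, minorTwo 0 1 1 0,
      minorTwo 0 2 2 0 (K := K)]).IsPrime := (isPrime_minorTwo_minorTwo_zero (K := K)).ofList_perm
    (List.perm_append_comm (l₁ := [_, _]) (l₂ := [_]))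
  have J4 := isPrime_minorTwo_zero (K := K)
  obtain ⟨b1, h1, h1'⟩ := exists_exchange (z := minorTwo 0 1 1 0)
    (J1.regularMod (not_mem_of_eval !![0, 1, 1, 0; 1, 0, 0, 0; 1, 1, 0, 0; 0, 0, 0, 0]
      (by simp [minorTwo, minorThree]) (by simp [minorTwo, minorThree])))
    (J1.regularMod (not_mem_of_eval !![0, 1, 1, 0; 1, 0, 0, 0; 1, 1, 0, 0; 0, 0, 0, 0]
      (by simp [minorTwo, minorThree]) (by simp [minorTwo]))) (by simp) hb
  rw [Ideal.ofList_rotate] at h1 h1'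
  obtain ⟨b2, h2, h2'⟩ := exists_exchange (z := minorTwo 0 2 2 0)
    (J2.regularMod (not_mem_of_eval !![0, 0, 1, 1; 1, 0, 0, 0; 1, 0, 0, 0; 0, 1, 0, 0]
      (by simp [minorTwo, minorThree]) (by simp [minorTwo, minorThree])))
    (J2.regularMod (not_mem_of_eval !![0, 0, 1, 1; 1, 0, 0, 0; 1, 0, 0, 0; 0, 1, 0, 0]
      (by simp [minorTwo, minorThree]) (by simp [minorTwo]))) (by simp) h1
  rw [Ideal.ofList_rotate] at h2 h2'
  obtain ⟨b3, h3, h3'⟩ := exists_exchange (z := minorTwo 0 3 3 0)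
    (J3.regularMod (not_mem_of_eval !![0, 0, 0, 1; 0, 0, 0, 0; 0, 0, 1, 1; 1, 1, 0, 0]
      (by simp [minorTwo, minorThree]) (by simp [minorTwo, minorThree])))
    (J3.regularMod (not_mem_of_eval !![0, 0, 0, 1; 0, 0, 0, 0; 0, 0, 1, 1; 1, 1, 0, 0]
      (by simp [minorTwo, minorThree]) (by simp [minorTwo]))) (by simp) h2
  rw [Ideal.ofList_rotate] at h3 h3'
  obtain ⟨b4, h4, h4'⟩ := exists_exchange (z := minorTwo 1 2 2 1)
    (J4.regularMod (not_mem_of_eval !![0, 0, 0, 0; 0, 0, 1, 0; 1, 1, 0, 0; 0, 0, 1, 1]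
      (by simp [minorTwo]) (by simp [minorTwo, minorThree])))
    (J4.regularMod (not_mem_of_eval !![0, 0, 0, 0; 0, 0, 1, 0; 1, 1, 0, 0; 0, 0, 1, 1]
      (by simp [minorTwo]) (by simp [minorTwo]))) (by simp) h3
  rw [← one_mul b]
  refine h1' 1 (h2' 1 (h3' 1 (h4' 1 ?_)))
  rw [one_mul]
  exact isPrime_minorTwo_one_minorTwo_zero.regularMod
    (not_mem_of_eval !![0, 0, 0, 0; 1, 1, 0, 0; 0, 0, 0, 0; 0, 0, 0, 1]
      (by simp [minorTwo]) (by simp [minorTwo])) _ (h4 (minorTwo 1 3 3 1) (by simp))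
end

section
open MvPolynomial
universe u v
variable {σ : Type u} [DecidableEq σ] {K : Type v} [Field K]

theorem Ideal.mem_ofList_of_eq {R : Type*} [CommRing R] {l : List R} {p : R} (c : List R)
    (h : p = (List.zipWith (· * ·) c l).sum) : p ∈ Ideal.ofList l := by
  subst h
  induction l generalizing c with
  | nil => simp
  | cons a l ih =>
    cases c with
    | nil => simp
    | cons b c =>
      rw [List.zipWith_cons_cons, List.sum_cons, Ideal.ofList_cons]
      exact add_mem (Ideal.mul_mem_left _ _ (Ideal.mem_sup_left (Ideal.mem_span_singleton_self a)))
        (Ideal.mem_sup_right (ih c))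

/-- Variant of `isPrime_append_linear` in which `m` lists pairs of a leading coefficient and the
corresponding generator, and the ideal of leading coefficients is prime. -/
theorem isPrime_append_of_coeff (x : σ) {l C : List (MvPolynomial σ K)}
    {m : List (MvPolynomial σ K × MvPolynomial σ K)} {q g : MvPolynomial σ K}
    (hN : (Ideal.ofList l).IsPrime) (hC : (Ideal.ofList C).IsPrime) (hqg : (q, g) ∈ m)
    (hl : ∀ p ∈ l, FreeOf (· = x) p)
    (hm : ∀ p ∈ m, FreeOf (· = x) p.1 ∧ FreeOf (· = x) (p.2 - X x * p.1))
    (hlC : ∀ p ∈ l ++ m.map Prod.fst, p ∈ Ideal.ofList C)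
    (hCl : C ⊆ l ++ m.map Prod.fst) (hq : q ∉ Ideal.ofList l)
    (hg : g - X x * q ∉ Ideal.ofList C)
    (hrel : ∀ p ∈ m, q * p.2 - p.1 * g ∈ Ideal.ofList l) :
    (Ideal.ofList (l ++ m.map Prod.snd)).IsPrime := by
  have hC' : Ideal.ofList (l ++ m.map Prod.fst) = Ideal.ofList C :=
    le_antisymm (Ideal.ofList_le hlC)
      (Ideal.ofList_le fun p hp => Ideal.mem_ofList_of_mem (hCl hp))
  have h := isPrime_append_linear x (m := m.map fun p => (p.1, p.2 - X x * p.1)) hN hl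
    (fun p hp => by
      obtain ⟨a, ha, rfl⟩ := List.mem_map.1 hp
      exact hm a ha) (List.mem_map_of_mem hqg) hq
    (by
      simp only [List.forall_mem_map]
      intro p hp
      convert hrel p hp using 1
      ring)
    (by
      rw [List.map_map, show Prod.fst ∘ (fun p : MvPolynomial σ K × MvPolynomial σ K =>
        (p.1, p.2 - X x * p.1)) = Prod.fst from rfl, hC']
      exact hC.regularMod hg)
  rw [List.map_map] at h
  simpa [Function.comp_def] using h

theorem isPrime_minorTwo_last :
    (Ideal.ofList [minorTwo 2 3 2 3] : Ideal (MvPolynomial (Fin 4 × Fin 4) K)).IsPrime :=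
  isPrime_cons_minorTwo isPrime_ofList_nil (by decide) (by decide) (by simp)
    (not_mem_of_eval (fun _ _ => 1) (by simp) (by simp))

theorem isPrime_vars (x y : σ) (h : x ≠ y) :
    (Ideal.ofList [X x, X y] : Ideal (MvPolynomial σ K)).IsPrime :=
  isPrime_cons_var _ (isPrime_cons_var _ isPrime_ofList_nil (by simp)) (by simp [FreeOf, h.symm])

theorem isPrime_vars_minorTwo :
    (Ideal.ofList [X (3, 2), X (3, 3), minorTwo 1 2 2 3] :
      Ideal (MvPolynomial (Fin 4 × Fin 4) K)).IsPrime :=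
  isPrime_cons_var _ (isPrime_cons_var _ (isPrime_cons_minorTwo isPrime_ofList_nil (by decide)
    (by decide) (by simp) (not_mem_of_eval (fun _ _ => 1) (by simp) (by simp)))
    (by simp [FreeOf, minorTwo])) (by simp [FreeOf, minorTwo])

theorem isPrime_four_vars :
    (Ideal.ofList [X (2, 2), X (2, 3), X (3, 2), X (3, 3)] :
      Ideal (MvPolynomial (Fin 4 × Fin 4) K)).IsPrime :=
  isPrime_cons_var _ (isPrime_cons_var _ (isPrime_vars _ _ (by decide)) (by simp [FreeOf]))
    (by simp [FreeOf])

/-- The `2`-minors of a `3 × 2` submatrix. -/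
theorem isPrime_rankOne_cols :
    (Ideal.ofList [minorTwo 2 3 2 3, minorTwo 1 2 2 3, minorTwo 1 3 2 3] :
      Ideal (MvPolynomial (Fin 4 × Fin 4) K)).IsPrime := by
  refine isPrime_append_of_coeff (1, 2) (m := [(X (2, 3), minorTwo 1 2 2 3), (X (3, 3),
      minorTwo 1 3 2 3)])
    isPrime_minorTwo_last (isPrime_vars (2, 3) (3, 3) (by decide)) (List.mem_cons_self ..)
    (by simp [FreeOf, minorTwo]) ?_ ?_ (by simp) ?_ ?_ ?_
  · simp only [List.forall_mem_cons]
    and_intros <;> simp [FreeOf, minorTwo]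
  · simp only [List.cons_append, List.nil_append, List.map_cons, List.map_nil, List.forall_mem_cons]
    refine ⟨Ideal.mem_ofList_of_eq [-X (3, 2), X (2, 2)] ?_, Ideal.mem_ofList_of_mem (by simp),
      Ideal.mem_ofList_of_mem (by simp), by simp⟩
    simp [minorTwo]; ring
  · exact not_mem_of_eval !![0, 1, 0, 0; 0, 0, 1, 0; 0, 0, 0, 1; 0, 1, 0, 0]
      (by simp [minorTwo]) (by simp)
  · exact not_mem_of_eval !![0, 0, 0, 0; 0, 0, 0, 1; 0, 0, 1, 0; 0, 0, 0, 0]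
      (by simp) (by simp [minorTwo])
  · simp only [List.forall_mem_cons]
    refine ⟨by simp [mul_comm], Ideal.mem_ofList_of_eq [X (1, 3)] ?_, by simp⟩
    simp [minorTwo]; ring

/-- The `2`-minors of a `2 × 3` submatrix. -/
theorem isPrime_rankOne_rows :
    (Ideal.ofList [minorTwo 2 3 2 3, minorTwo 2 3 1 2, minorTwo 2 3 1 3] :
      Ideal (MvPolynomial (Fin 4 × Fin 4) K)).IsPrime := by
  refine isPrime_append_of_coeff (2, 1) (m := [(X (3, 2), minorTwo 2 3 1 2), (X (3, 3),
      minorTwo 2 3 1 3)])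
    isPrime_minorTwo_last (isPrime_vars (3, 2) (3, 3) (by decide)) (List.mem_cons_self ..)
    (by simp [FreeOf, minorTwo]) ?_ ?_ (by simp) ?_ ?_ ?_
  · simp only [List.forall_mem_cons]
    and_intros <;> simp [FreeOf, minorTwo]
  · simp only [List.cons_append, List.nil_append, List.map_cons, List.map_nil, List.forall_mem_cons]
    refine ⟨Ideal.mem_ofList_of_eq [-X (2, 3), X (2, 2)] ?_, Ideal.mem_ofList_of_mem (by simp),
      Ideal.mem_ofList_of_mem (by simp), by simp⟩
    simp [minorTwo]; ring
  · exact not_mem_of_eval !![0, 0, 1, 0; 0, 0, 1, 0; 0, 0, 0, 0; 0, 0, 1, 0]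
      (by simp [minorTwo]) (by simp)
  · exact not_mem_of_eval !![0, 0, 0, 1; 0, 0, 0, 0; 1, 0, 1, 1; 0, 1, 0, 0]
      (by simp) (by simp [minorTwo])
  · simp only [List.forall_mem_cons]
    refine ⟨by simp [mul_comm], Ideal.mem_ofList_of_eq [X (3, 1)] ?_, by simp⟩
    simp [minorTwo]; ring

theorem isPrime_rankOne_cols_rows :
    (Ideal.ofList [minorTwo 2 3 2 3, minorTwo 1 2 2 3, minorTwo 1 3 2 3, minorTwo 2 3 1 2,
        minorTwo 2 3 1 3] :
      Ideal (MvPolynomial (Fin 4 × Fin 4) K)).IsPrime := by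
  refine isPrime_append_of_coeff (2, 1) (m := [(X (3, 2), minorTwo 2 3 1 2), (X (3, 3),
      minorTwo 2 3 1 3)])
    isPrime_rankOne_cols isPrime_vars_minorTwo (List.mem_cons_self ..)
    (by simp [FreeOf, minorTwo]) ?_ ?_ (by simp) ?_ ?_ ?_
  · simp only [List.forall_mem_cons]
    and_intros <;> simp [FreeOf, minorTwo]
  · simp only [List.cons_append, List.nil_append, List.map_cons, List.map_nil, List.forall_mem_cons]
    refine ⟨Ideal.mem_ofList_of_eq [-X (2, 3), X (2, 2)] ?_, Ideal.mem_ofList_of_mem (by simp),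
      Ideal.mem_ofList_of_eq [-X (1, 3), X (1, 2)] ?_, Ideal.mem_ofList_of_mem (by simp),
      Ideal.mem_ofList_of_mem (by simp), by simp⟩
    all_goals simp [minorTwo]; ring
  · exact not_mem_of_eval !![0, 1, 0, 0; 1, 0, 0, 0; 0, 0, 1, 0; 0, 0, 1, 0]
      (by simp [minorTwo]) (by simp)
  · exact not_mem_of_eval !![0, 0, 0, 0; 0, 0, 0, 0; 0, 0, 1, 0; 0, 1, 0, 0]
      (by simp [minorTwo]) (by simp [minorTwo])
  · simp only [List.forall_mem_cons]
    refine ⟨by simp [mul_comm], Ideal.mem_ofList_of_eq [X (3, 1)] ?_, by simp⟩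
    simp [minorTwo]; ring

/-- The `2`-minors of a `3 × 3` submatrix. -/
theorem isPrime_rankOne :
    (Ideal.ofList [minorTwo 2 3 2 3, minorTwo 1 2 2 3, minorTwo 1 3 2 3, minorTwo 2 3 1 2, minorTwo 2 3 1 3,
      minorTwo 1 2 1 2, minorTwo 1 2 1 3, minorTwo 1 3 1 2, minorTwo 1 3 1 3] :
      Ideal (MvPolynomial (Fin 4 × Fin 4) K)).IsPrime := by
  refine isPrime_append_of_coeff (1, 1) (m := [(X (2, 2), minorTwo 1 2 1 2), (X (2, 3),
      minorTwo 1 2 1 3), (X (3, 2), minorTwo 1 3 1 2),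
    (X (3, 3), minorTwo 1 3 1 3)])
    isPrime_rankOne_cols_rows isPrime_four_vars (List.mem_cons_self ..)
    (by simp [FreeOf, minorTwo]) ?_ ?_ (by simp) ?_ ?_ ?_
  · simp only [List.forall_mem_cons]
    and_intros <;> simp [FreeOf, minorTwo]
  · simp only [List.cons_append, List.nil_append, List.map_cons, List.map_nil, List.forall_mem_cons]
    refine ⟨Ideal.mem_ofList_of_eq [X (3, 3), -X (3, 2)] ?_,
      Ideal.mem_ofList_of_eq [-X (1, 3), X (1, 2)] ?_,
      Ideal.mem_ofList_of_eq [0, 0, -X (1, 3), X (1, 2)] ?_,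
      Ideal.mem_ofList_of_eq [-X (3, 1), 0, X (2, 1)] ?_,
      Ideal.mem_ofList_of_eq [0, -X (3, 1), 0, X (2, 1)] ?_, Ideal.mem_ofList_of_mem (by simp),
      Ideal.mem_ofList_of_mem (by simp), Ideal.mem_ofList_of_mem (by simp),
      Ideal.mem_ofList_of_mem (by simp), by simp⟩
    all_goals simp [minorTwo]; ring
  · exact not_mem_of_eval !![1, 0, 0, 0; 0, 0, 1, 0; 0, 0, 1, 0; 1, 0, 0, 0]
      (by simp [minorTwo]) (by simp)
  · exact not_mem_of_eval !![0, 0, 0, 0; 1, 0, 1, 0; 0, 1, 0, 0; 0, 0, 0, 0]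
      (by simp) (by simp [minorTwo])
  · simp only [List.forall_mem_cons]
    refine ⟨by simp [mul_comm], Ideal.mem_ofList_of_eq [0, X (2, 1)] ?_,
      Ideal.mem_ofList_of_eq [0, 0, 0, X (1, 2)] ?_,
      Ideal.mem_ofList_of_eq [0, X (3, 1), 0, 0, X (1, 2)] ?_, by simp⟩
    all_goals simp [minorTwo]; ring

theorem isPrime_rankOne_cols_minorThree :
    (Ideal.ofList [minorTwo 2 3 2 3, minorTwo 1 2 2 3, minorTwo 1 3 2 3, minorThree 1 2 3 0 1 2,
      minorThree 1 2 3 0 1 3] :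
      Ideal (MvPolynomial (Fin 4 × Fin 4) K)).IsPrime := by
  refine isPrime_append_of_coeff (1, 0) (m := [(minorTwo 2 3 1 2, minorThree 1 2 3 0 1 2),
      (minorTwo 2 3 1 3, minorThree 1 2 3 0 1 3)])
    isPrime_rankOne_cols isPrime_rankOne_cols_rows (List.mem_cons_self ..)
    (by simp [FreeOf, minorTwo]) ?_ ?_ (by simp) ?_ ?_ ?_
  · simp only [List.forall_mem_cons]
    and_intros <;> simp [FreeOf, minorTwo, minorThree] <;> ring
  · simp only [List.cons_append, List.nil_append, List.map_cons, List.map_nil, List.forall_mem_cons]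
    refine ⟨Ideal.mem_ofList_of_mem (by simp), Ideal.mem_ofList_of_mem (by simp),
      Ideal.mem_ofList_of_mem (by simp), Ideal.mem_ofList_of_mem (by simp),
      Ideal.mem_ofList_of_mem (by simp), by simp⟩
  · exact not_mem_of_eval !![0, 0, 1, 0; 0, 0, 0, 0; 0, 1, 0, 0; 0, 0, 1, 0]
      (by simp [minorTwo]) (by simp [minorTwo])
  · exact not_mem_of_eval !![0, 0, 0, 0; 0, 0, 1, 0; 1, 0, 0, 0; 1, 1, 0, 0]
      (by simp [minorTwo]) (by simp [minorTwo, minorThree])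
  · simp only [List.forall_mem_cons]
    refine ⟨by simp [mul_comm],
      Ideal.mem_ofList_of_eq [X (1, 1) * minorTwo 2 3 0 1, X (3, 1) * minorTwo 2 3 0 1, -X (2,
          1) * minorTwo 2 3 0 1] ?_,
      by simp⟩
    simp [minorTwo, minorThree]; ring

/-- The `3`-minors of a `3 × 4` submatrix. -/
theorem isPrime_rankTwo_rows :
    (Ideal.ofList [minorThree 1 2 3 1 2 3, minorThree 1 2 3 0 2 3, minorThree 1 2 3 0 1 2,
        minorThree 1 2 3 0 1 3] :
      Ideal (MvPolynomial (Fin 4 × Fin 4) K)).IsPrime := by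
  refine isPrime_append_of_coeff (1, 0) (m := [(minorTwo 2 3 2 3, minorThree 1 2 3 0 2 3),
      (minorTwo 2 3 1 2, minorThree 1 2 3 0 1 2),
    (minorTwo 2 3 1 3, minorThree 1 2 3 0 1 3)])
    isPrime_minor_zero isPrime_rankOne_rows (List.mem_cons_self ..)
    (by simp [FreeOf, minorTwo, minorThree]) ?_ ?_ (by simp) ?_ ?_ ?_
  · simp only [List.forall_mem_cons]
    and_intros <;> simp [FreeOf, minorTwo, minorThree] <;> ring
  · simp only [List.cons_append, List.nil_append, List.map_cons, List.map_nil, List.forall_mem_cons]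
    refine ⟨Ideal.mem_ofList_of_eq [X (1, 1), X (1, 3), -X (1, 2)] ?_, Ideal.mem_ofList_of_mem (by simp),
      Ideal.mem_ofList_of_mem (by simp), Ideal.mem_ofList_of_mem (by simp), by simp⟩
    simp [minorTwo, minorThree]; ring
  · exact not_mem_of_eval !![0, 1, 0, 0; 0, 0, 0, 0; 0, 0, 1, 0; 0, 1, 0, 1]
      (by simp [minorTwo, minorThree]) (by simp [minorTwo])
  · exact not_mem_of_eval !![0, 0, 1, 1; 0, 0, 1, 0; 0, 0, 0, 1; 1, 0, 0, 0]
      (by simp [minorTwo]) (by simp [minorTwo, minorThree])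
  · simp only [List.forall_mem_cons]
    refine ⟨by simp [mul_comm], Ideal.mem_ofList_of_eq [-minorTwo 2 3 0 2] ?_,
      Ideal.mem_ofList_of_eq [-minorTwo 2 3 0 3] ?_, by simp⟩
    all_goals simp [minorTwo, minorThree]; ring

/-- The `3`-minors that do not involve the first variable. -/
theorem isPrime_rankTwo_hook :
    (Ideal.ofList [minorThree 1 2 3 1 2 3, minorThree 1 2 3 0 2 3, minorThree 1 2 3 0 1 2,
      minorThree 1 2 3 0 1 3, minorThree 0 2 3 1 2 3, minorThree 0 1 2 1 2 3, minorThree 0 1 3 1 2 3] :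
      Ideal (MvPolynomial (Fin 4 × Fin 4) K)).IsPrime := by
  refine isPrime_append_of_coeff (0, 1) (m := [(minorTwo 2 3 2 3, minorThree 0 2 3 1 2 3),
      (minorTwo 1 2 2 3, minorThree 0 1 2 1 2 3),
    (minorTwo 1 3 2 3, minorThree 0 1 3 1 2 3)])
    isPrime_rankTwo_rows isPrime_rankOne_cols_minorThree (List.mem_cons_self ..)
    (by simp [FreeOf, minorTwo, minorThree]) ?_ ?_ (by simp) ?_ ?_ ?_
  · simp only [List.forall_mem_cons]
    and_intros <;> simp [FreeOf, minorTwo, minorThree] <;> ring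
  · simp only [List.cons_append, List.nil_append, List.map_cons, List.map_nil, List.forall_mem_cons]
    refine ⟨Ideal.mem_ofList_of_eq [X (1, 1), X (3, 1), -X (2, 1)] ?_,
      Ideal.mem_ofList_of_eq [X (1, 0), X (3, 0), -X (2, 0)] ?_, Ideal.mem_ofList_of_mem (by simp),
      Ideal.mem_ofList_of_mem (by simp), Ideal.mem_ofList_of_mem (by simp),
      Ideal.mem_ofList_of_mem (by simp), Ideal.mem_ofList_of_mem (by simp), by simp⟩
    all_goals simp [minorTwo, minorThree]; ring
  · exact not_mem_of_eval !![0, 0, 0, 0; 0, 0, 0, 0; 1, 1, 0, 1; 0, 0, 1, 0]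
      (by simp [minorTwo, minorThree]) (by simp [minorTwo])
  · exact not_mem_of_eval !![0, 0, 1, 0; 0, 0, 0, 0; 0, 1, 0, 1; 0, 1, 0, 0]
      (by simp [minorTwo, minorThree]) (by simp [minorTwo, minorThree])
  · simp only [List.forall_mem_cons]
    refine ⟨by simp [mul_comm], Ideal.mem_ofList_of_eq [-minorTwo 0 2 2 3] ?_,
      Ideal.mem_ofList_of_eq [-minorTwo 0 3 2 3] ?_, by simp⟩
    all_goals simp [minorTwo, minorThree]; ring

set_option maxHeartbeats 1600000 in
/-- The ideal of all `3`-minors of the generic `4 × 4` matrix is prime. -/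
theorem isPrime_rankTwo :
    (Ideal.ofList [minorThree 1 2 3 1 2 3, minorThree 1 2 3 0 2 3, minorThree 1 2 3 0 1 2,
      minorThree 1 2 3 0 1 3, minorThree 0 2 3 1 2 3, minorThree 0 1 2 1 2 3,
      minorThree 0 1 3 1 2 3, minorThree 0 2 3 0 2 3, minorThree 0 2 3 0 1 2,
      minorThree 0 2 3 0 1 3, minorThree 0 1 2 0 2 3, minorThree 0 1 2 0 1 2,
      minorThree 0 1 2 0 1 3, minorThree 0 1 3 0 2 3, minorThree 0 1 3 0 1 2, minorThree 0 1 3 0 1 3] :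
      Ideal (MvPolynomial (Fin 4 × Fin 4) K)).IsPrime := by
  refine isPrime_append_of_coeff (0, 0) (m := [(minorTwo 2 3 2 3, minorThree 0 2 3 0 2 3),
      (minorTwo 2 3 1 2, minorThree 0 2 3 0 1 2),
    (minorTwo 2 3 1 3, minorThree 0 2 3 0 1 3), (minorTwo 1 2 2 3, minorThree 0 1 2 0 2 3),
    (minorTwo 1 2 1 2, minorThree 0 1 2 0 1 2), (minorTwo 1 2 1 3, minorThree 0 1 2 0 1 3),
    (minorTwo 1 3 2 3, minorThree 0 1 3 0 2 3), (minorTwo 1 3 1 2, minorThree 0 1 3 0 1 2),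
    (minorTwo 1 3 1 3, minorThree 0 1 3 0 1 3)])
    isPrime_rankTwo_hook isPrime_rankOne (List.mem_cons_self ..)
    (by simp [FreeOf, minorTwo, minorThree]) ?_ ?_ (by simp) ?_ ?_ ?_
  · simp only [List.forall_mem_cons]
    and_intros <;> simp [FreeOf, minorTwo, minorThree] <;> ring
  · simp only [List.cons_append, List.nil_append, List.map_cons, List.map_nil, List.forall_mem_cons]
    refine ⟨Ideal.mem_ofList_of_eq [X (1, 1), X (3, 1), -X (2, 1)] ?_,
      Ideal.mem_ofList_of_eq [X (1, 0), X (3, 0), -X (2, 0)] ?_,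
      Ideal.mem_ofList_of_eq [0, 0, 0, X (1, 0), 0, X (3, 0), 0, -X (2, 0)] ?_,
      Ideal.mem_ofList_of_eq [0, 0, 0, 0, X (1, 0), 0, X (3, 0), 0, -X (2, 0)] ?_,
      Ideal.mem_ofList_of_eq [X (0, 1), 0, 0, X (0, 3), -X (0, 2)] ?_,
      Ideal.mem_ofList_of_eq [0, X (0, 1), 0, 0, 0, X (0, 3), -X (0, 2)] ?_,
      Ideal.mem_ofList_of_eq [0, 0, X (0, 1), 0, 0, 0, 0, X (0, 3), -X (0, 2)] ?_,
      Ideal.mem_ofList_of_mem (by simp), Ideal.mem_ofList_of_mem (by simp),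
      Ideal.mem_ofList_of_mem (by simp), Ideal.mem_ofList_of_mem (by simp),
      Ideal.mem_ofList_of_mem (by simp), Ideal.mem_ofList_of_mem (by simp),
      Ideal.mem_ofList_of_mem (by simp), Ideal.mem_ofList_of_mem (by simp),
      Ideal.mem_ofList_of_mem (by simp), by simp⟩
    all_goals simp [minorTwo, minorThree]; ring
  · exact not_mem_of_eval !![0, 0, 0, 0; 0, 0, 1, 0; 0, 0, 1, 0; 0, 0, 0, 1]
      (by simp [minorTwo, minorThree]) (by simp [minorTwo])
  · exact not_mem_of_eval !![0, 0, 1, 0; 0, 0, 0, 0; 1, 0, 0, 0; 0, 0, 1, 1]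
      (by simp [minorTwo]) (by simp [minorTwo, minorThree])
  · simp only [List.forall_mem_cons]
    refine ⟨by simp [mul_comm], Ideal.mem_ofList_of_eq [0, 0, 0, 0, -minorTwo 2 3 0 2] ?_,
      Ideal.mem_ofList_of_eq [0, 0, 0, 0, -minorTwo 2 3 0 3] ?_,
      Ideal.mem_ofList_of_eq [0, -minorTwo 0 2 2 3] ?_,
      Ideal.mem_ofList_of_eq [0, -minorTwo 0 2 1 2, 0, 0, 0, -minorTwo 2 3 0 2] ?_,
      Ideal.mem_ofList_of_eq [0, -minorTwo 0 2 1 3, 0, 0, 0, -minorTwo 2 3 0 3] ?_,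
      Ideal.mem_ofList_of_eq [0, -minorTwo 0 3 2 3] ?_,
      Ideal.mem_ofList_of_eq [0, -minorTwo 0 3 1 2, 0, 0, 0, 0, -minorTwo 2 3 0 2] ?_,
      Ideal.mem_ofList_of_eq [0, -minorTwo 0 3 1 3, 0, 0, 0, 0, -minorTwo 2 3 0 3] ?_, by simp⟩
    all_goals simp [minorTwo, minorThree]; ring

end

section
open MvPolynomial
universe v
variable (K : Type v) [Field K]

/-- The polynomial obtained by eliminating `x₀₀`, `x₁₁`, `x₁₀` from the principal `3`-minors. -/
noncomputable def eliminant : MvPolynomial (Fin 4 × Fin 4) K :=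
  minorTwo 0 2 1 2 * minorTwo 1 3 2 3 * minorTwo 2 3 0 3 -
    minorTwo 0 3 1 3 * minorTwo 1 2 2 3 * minorTwo 2 3 0 2

theorem isPrime_eliminant_coeff_coeff :
    (Ideal.ofList [X (3, 3) ^ 2 * minorTwo 0 2 1 2 - X (3, 2) * X (2, 3) * minorTwo 0 3 1 3] :
      Ideal (MvPolynomial (Fin 4 × Fin 4) K)).IsPrime := by
  have hv : ∀ x, (Ideal.ofList [X x] : Ideal (MvPolynomial (Fin 4 × Fin 4) K)).IsPrime := fun x =>
    isPrime_cons_var x isPrime_ofList_nil (by simp)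
  have h0 : ∀ x, RegularMod (X x : MvPolynomial (Fin 4 × Fin 4) K) (Ideal.ofList []) := fun x =>
    isPrime_ofList_nil.regularMod (not_mem_of_eval (fun _ _ => 1) (by simp) (by simp))
  have h := isPrime_cons_linear (K := K) (0, 3) (l := []) (q := X (3, 2) * (X (2, 3) * X (3, 1)))
    (r := X (3, 3) * (X (3, 3) * minorTwo 0 2 1 2 - X (3, 2) * X (2, 3) * X (0, 1)))
    isPrime_ofList_nil (by simp) (by simp [FreeOf]) (by simp [FreeOf, minorTwo])
    (not_mem_of_eval (fun _ _ => 1) (by simp) (by simp))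
    (.mul_left (h0 _) ((hv _).regularMod ?_)
      (.mul_left (h0 _) ((hv _).regularMod ?_) ((hv _).regularMod ?_)))
  · convert h using 3
    simp only [minorTwo]; ring
  · exact not_mem_of_eval !![0, 1, 0, 1; 0, 0, 0, 0; 0, 0, 1, 1; 0, 0, 0, 1] (by simp)
      (by simp [minorTwo])
  · exact not_mem_of_eval !![0, 1, 0, 0; 0, 0, 0, 0; 0, 1, 1, 0; 1, 0, 0, 1] (by simp)
      (by simp [minorTwo])
  · exact not_mem_of_eval !![0, 1, 1, 0; 0, 0, 0, 0; 0, 1, 0, 0; 0, 0, 0, 1] (by simp)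
      (by simp [minorTwo])

theorem isPrime_eliminant_coeff :
    (Ideal.ofList [X (3, 3) * (minorTwo 0 2 1 2 * minorTwo 1 3 2 3) -
      X (3, 2) * (minorTwo 0 3 1 3 * minorTwo 1 2 2 3)] :
      Ideal (MvPolynomial (Fin 4 × Fin 4) K)).IsPrime := by
  have h := isPrime_cons_linear (K := K) (1, 2) (l := [])
    (q := X (3, 3) ^ 2 * minorTwo 0 2 1 2 - X (3, 2) * X (2, 3) * minorTwo 0 3 1 3)
    (r := X (1, 3) * X (3, 2) * (X (2, 2) * minorTwo 0 3 1 3 - X (3, 3) * minorTwo 0 2 1 2))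
    isPrime_ofList_nil (by simp) (by simp [FreeOf, minorTwo]) (by simp [FreeOf, minorTwo])
    (not_mem_of_eval !![0, 1, 1, 0; 0, 0, 0, 0; 0, 0, 1, 0; 0, 1, 0, 1] (by simp)
      (by simp [minorTwo]))
    ((isPrime_eliminant_coeff_coeff K).regularMod
      (not_mem_of_eval !![1, 0, 0, 1; 0, 0, 0, 1; 0, 0, 1, 0; 1, 1, 1, 0] (by simp [minorTwo])
        (by simp [minorTwo])))
  convert h using 3
  simp only [minorTwo]; ring

theorem isPrime_eliminant :
    (Ideal.ofList [eliminant K]).IsPrime := by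
  have h := isPrime_cons_linear (K := K) (2, 0) (l := [])
    (q := X (3, 3) * (minorTwo 0 2 1 2 * minorTwo 1 3 2 3) -
      X (3, 2) * (minorTwo 0 3 1 3 * minorTwo 1 2 2 3))
    (r := -(X (3, 0) * (X (2, 3) * (minorTwo 0 2 1 2 * minorTwo 1 3 2 3) -
      X (2, 2) * (minorTwo 0 3 1 3 * minorTwo 1 2 2 3))))
    isPrime_ofList_nil (by simp) (by simp [FreeOf, minorTwo]) (by simp [FreeOf, minorTwo])
    (not_mem_of_eval !![0, 0, 1, 1; 0, 0, 1, 0; 1, 1, 0, 0; 0, 1, 0, 1] (by simp)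
      (by simp [minorTwo]))
    ((isPrime_eliminant_coeff K).regularMod
      (not_mem_of_eval !![0, 1, 1, 0; 0, 0, 0, 1; 0, 0, 1, 1; 1, 0, 1, 0] (by simp [minorTwo])
        (by simp [minorTwo])))
  convert h using 3
  simp only [minorTwo, eliminant]; ring
end

section
open MvPolynomial
universe v
variable (K : Type v) [Field K]

theorem eliminate_two :
    minorTwo 2 3 2 3 ^ 2 * minorThree 0 1 3 0 1 3 +
      minorTwo 2 3 2 3 * minorTwo 0 3 1 3 * minorThree 1 2 3 0 2 3 +
      minorTwo 1 3 2 3 * minorTwo 2 3 0 3 * minorThree 0 2 3 1 2 3 =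
    (X (3, 3) * (X (0, 2) * minorTwo 2 3 0 3 - X (0, 3) * minorTwo 2 3 0 2) -
        X (0, 3) * X (3, 0) * minorTwo 2 3 2 3) * minorThree 1 2 3 1 2 3 +
      (X (3, 3) * X (1, 1) * minorTwo 2 3 2 3 - X (1, 3) * X (3, 1) * minorTwo 2 3 2 3) *
        minorThree 0 2 3 0 2 3 (K := K) := by
  simp only [minorTwo, minorThree]; ring

theorem eliminate_three :
    minorTwo 2 3 2 3 ^ 2 * minorThree 0 1 2 0 1 2 +
      minorTwo 2 3 2 3 * minorTwo 0 2 1 2 * minorThree 1 2 3 0 2 3 +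
      minorTwo 1 2 2 3 * minorTwo 2 3 0 2 * minorThree 0 2 3 1 2 3 =
    (X (2, 2) * (X (0, 2) * minorTwo 2 3 0 3 - X (0, 3) * minorTwo 2 3 0 2) -
        X (0, 2) * X (2, 0) * minorTwo 2 3 2 3) * minorThree 1 2 3 1 2 3 +
      (X (2, 2) * X (1, 1) * minorTwo 2 3 2 3 - X (1, 2) * X (2, 1) * minorTwo 2 3 2 3) *
        minorThree 0 2 3 0 2 3 (K := K) := by
  simp only [minorTwo, minorThree]; ring

/-- The ideal of principal `3`-minors of the generic `4 × 4` matrix. -/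
noncomputable def principalIdeal : Ideal (MvPolynomial (Fin 4 × Fin 4) K) :=
  Ideal.ofList [minorThree 0 1 2 0 1 2, minorThree 0 1 3 0 1 3, minorThree 0 2 3 0 2 3,
    minorThree 1 2 3 1 2 3]

/-- The determinant of the generic `4 × 4` matrix, expanded along the first row. -/
noncomputable def minorFour : MvPolynomial (Fin 4 × Fin 4) K :=
  X (0, 0) * minorThree 1 2 3 1 2 3 - X (0, 1) * minorThree 1 2 3 0 2 3 +
    X (0, 2) * minorThree 1 2 3 0 1 3 - X (0, 3) * minorThree 1 2 3 0 1 2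

/-- The ideal of all `3`-minors of the generic `4 × 4` matrix. -/
noncomputable def minorIdeal : Ideal (MvPolynomial (Fin 4 × Fin 4) K) :=
  Ideal.ofList [minorThree 1 2 3 1 2 3, minorThree 1 2 3 0 2 3, minorThree 1 2 3 0 1 2,
      minorThree 1 2 3 0 1 3, minorThree 0 2 3 1 2 3, minorThree 0 1 2 1 2 3,
      minorThree 0 1 3 1 2 3, minorThree 0 2 3 0 2 3, minorThree 0 2 3 0 1 2,
      minorThree 0 2 3 0 1 3, minorThree 0 1 2 0 2 3, minorThree 0 1 2 0 1 2,
      minorThree 0 1 2 0 1 3, minorThree 0 1 3 0 2 3, minorThree 0 1 3 0 1 2,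
      minorThree 0 1 3 0 1 3]

variable {K}

theorem mem_satIdeal_mul {R : Type*} [CommRing R] {A B I : Ideal R} {z a b : R}
    (ha : a ∈ satIdeal z A) (hb : b ∈ satIdeal z B) (h : A * B ≤ I) : a * b ∈ satIdeal z I := by
  obtain ⟨n, hn⟩ := ha
  obtain ⟨m, hm⟩ := hb
  refine ⟨n + m, ?_⟩
  convert h (Ideal.mul_mem_mul hn hm) using 1
  ring

theorem minorThree_mul_eliminant_mem :
    minorThree 0 2 3 1 2 3 * eliminant K ∈ principalIdeal K := by
  refine Ideal.mem_ofList_of_eq [minorTwo 2 3 2 3 ^ 2 * minorTwo 0 3 1 3,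
    -minorTwo 2 3 2 3 ^ 2 * minorTwo 0 2 1 2,
    minorTwo 0 2 1 2 * (X (3, 3) * X (1, 1) * minorTwo 2 3 2 3 -
      X (1, 3) * X (3, 1) * minorTwo 2 3 2 3) - minorTwo 0 3 1 3 *
      (X (2, 2) * X (1, 1) * minorTwo 2 3 2 3 - X (1, 2) * X (2, 1) * minorTwo 2 3 2 3),
    minorTwo 0 2 1 2 * (X (3, 3) * (X (0, 2) * minorTwo 2 3 0 3 - X (0, 3) * minorTwo 2 3 0 2) -
        X (0, 3) * X (3, 0) * minorTwo 2 3 2 3) - minorTwo 0 3 1 3 *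
        (X (2, 2) * (X (0, 2) * minorTwo 2 3 0 3 - X (0, 3) * minorTwo 2 3 0 2) -
        X (0, 2) * X (2, 0) * minorTwo 2 3 2 3)] ?_
  simp only [List.zipWith_cons_cons, List.zipWith_nil_right, List.sum_cons, List.sum_nil,
    eliminant]
  linear_combination minorTwo 0 2 1 2 * eliminate_two K - minorTwo 0 3 1 3 * eliminate_three K

set_option maxHeartbeats 1000000 in
theorem minors_le_satIdeal {W : Ideal (MvPolynomial (Fin 4 × Fin 4) K)}
    (hM : ∀ b, minorTwo 2 3 2 3 * b ∈ W → b ∈ W) (hy : ∀ b, minorTwo 0 3 1 3 * b ∈ W → b ∈ W)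
    (h00 : minorThree 1 2 3 1 2 3 ∈ W) (h11 : minorThree 0 2 3 0 2 3 ∈ W)
    (h22 : minorThree 0 1 3 0 1 3 ∈ W) (h10 : minorThree 0 2 3 1 2 3 ∈ W) :
    minorIdeal K ≤ W := by
  have mk : ∀ {p a b : MvPolynomial (Fin 4 × Fin 4) K} (c d), a ∈ W → b ∈ W →
      p = c * a + d * b → p ∈ W := fun c d ha hb h =>
    h ▸ W.add_mem (W.mul_mem_left c ha) (W.mul_mem_left d hb)
  have mk3 : ∀ {p a b e f : MvPolynomial (Fin 4 × Fin 4) K} (c d g h), a ∈ W → b ∈ W → e ∈ W →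
      f ∈ W → p = c * a + d * b + g * e + h * f → p ∈ W := fun c d g h ha hb he hf h' =>
    h' ▸ W.add_mem (W.add_mem (W.add_mem (W.mul_mem_left c ha) (W.mul_mem_left d hb))
      (W.mul_mem_left g he)) (W.mul_mem_left h hf)
  have h01 : minorThree 1 2 3 0 2 3 ∈ W := hM _ (hy _ (mk3
    (X (3, 3) * (X (0, 2) * minorTwo 2 3 0 3 - X (0, 3) * minorTwo 2 3 0 2) -
      X (0, 3) * X (3, 0) * minorTwo 2 3 2 3)
    (X (3, 3) * X (1, 1) * minorTwo 2 3 2 3 - X (1, 3) * X (3, 1) * minorTwo 2 3 2 3)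
    (-(minorTwo 2 3 2 3 ^ 2)) (-(minorTwo 1 3 2 3 * minorTwo 2 3 0 3)) h00 h11 h22 h10
    (by linear_combination eliminate_two K)))
  have h03 : minorThree 1 2 3 0 1 2 ∈ W := hM _ (mk (-minorTwo 2 3 0 2) (minorTwo 2 3 1 2) h00 h01
    (by simp only [minorTwo, minorThree]; ring))
  have h02 : minorThree 1 2 3 0 1 3 ∈ W := hM _ (mk (-minorTwo 2 3 0 3) (minorTwo 2 3 1 3) h00 h01
    (by simp only [minorTwo, minorThree]; ring))
  have h13 : minorThree 0 2 3 0 1 2 ∈ W := hM _ (mk (-minorTwo 2 3 0 2) (minorTwo 2 3 1 2) h10 h11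
    (by simp only [minorTwo, minorThree]; ring))
  have h12 : minorThree 0 2 3 0 1 3 ∈ W := hM _ (mk (-minorTwo 2 3 0 3) (minorTwo 2 3 1 3) h10 h11
    (by simp only [minorTwo, minorThree]; ring))
  have h30 : minorThree 0 1 2 1 2 3 ∈ W := hM _ (mk (-minorTwo 0 2 2 3) (minorTwo 1 2 2 3) h00 h10
    (by simp only [minorTwo, minorThree]; ring))
  have h20 : minorThree 0 1 3 1 2 3 ∈ W := hM _ (mk (-minorTwo 0 3 2 3) (minorTwo 1 3 2 3) h00 h10
    (by simp only [minorTwo, minorThree]; ring))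
  have h31 : minorThree 0 1 2 0 2 3 ∈ W := hM _ (mk (-minorTwo 0 2 2 3) (minorTwo 1 2 2 3) h01 h11
    (by simp only [minorTwo, minorThree]; ring))
  have h21 : minorThree 0 1 3 0 2 3 ∈ W := hM _ (mk (-minorTwo 0 3 2 3) (minorTwo 1 3 2 3) h01 h11
    (by simp only [minorTwo, minorThree]; ring))
  have hΔ : minorFour K ∈ W := by
    rw [minorFour]
    exact mk3 (X (0, 0)) (-X (0, 1)) (X (0, 2)) (-X (0, 3)) h00 h01 h02 h03 (by ring)
  have h23 : minorThree 0 1 3 0 1 2 ∈ W := by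
    refine hM _ (mk (X (2, 2)) (-X (3, 2)) (a := X (3, 3) * minorThree 0 1 3 0 1 2)
      (b := X (2, 3) * minorThree 0 1 3 0 1 2)
      (mk3 (X (3, 0)) (-X (3, 1)) (X (3, 2)) 0 h20 h21 h22 hΔ ?_)
      (mk3 (X (2, 0)) (-X (2, 1)) (X (2, 2)) (-1) h20 h21 h22 hΔ ?_) ?_) <;>
      (simp only [minorTwo, minorThree, minorFour]; ring)
  have h32 : minorThree 0 1 2 0 1 3 ∈ W := by
    refine hM _ (mk (X (2, 2)) (-X (2, 3)) (a := X (3, 3) * minorThree 0 1 2 0 1 3)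
      (b := X (3, 2) * minorThree 0 1 2 0 1 3)
      (mk3 (X (0, 3)) (-X (1, 3)) (X (2, 3)) 0 h02 h12 h22 hΔ ?_)
      (mk3 (X (0, 2)) (-X (1, 2)) (X (2, 2)) (-1) h02 h12 h22 hΔ ?_) ?_) <;>
      (simp only [minorTwo, minorThree, minorFour]; ring)
  have h33 : minorThree 0 1 2 0 1 2 ∈ W := hM _ (hM _ (mk3
    (X (2, 2) * (X (0, 2) * minorTwo 2 3 0 3 - X (0, 3) * minorTwo 2 3 0 2) -
        X (0, 2) * X (2, 0) * minorTwo 2 3 2 3)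
    (X (2, 2) * X (1, 1) * minorTwo 2 3 2 3 - X (1, 2) * X (2, 1) * minorTwo 2 3 2 3)
    (-(minorTwo 2 3 2 3 * minorTwo 0 2 1 2)) (-(minorTwo 1 2 2 3 * minorTwo 2 3 0 2))
    h00 h11 h01 h10 (by linear_combination eliminate_three K)))
  rw [minorIdeal]
  refine Ideal.ofList_le ?_
  simp only [List.forall_mem_cons]
  exact ⟨h00, h01, h03, h02, h10, h30, h20, h11, h13, h12, h31, h33, h32, h21, h23, h22,
    fun _ h => (List.not_mem_nil h).elim⟩
end

section
open MvPolynomial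
universe v
variable {K : Type v} [Field K]

/-- The kernel of a substitution is contained in a saturation. -/
theorem mem_satIdeal_of_hom {σ : Type*} {F : Type*} [CommRing F] [Algebra K F]
    {s : σ → Prop} [DecidablePred s] {J N : Ideal (MvPolynomial σ K)} {z : MvPolynomial σ K}
    {φ χ : MvPolynomial σ K →ₐ[K] F} (hφχ : ∀ j, ¬ s j → φ (X j) = χ (X j))
    (hχ : ∀ p, χ p = 0 → p ∈ N) (hJ : ∀ p ∈ J, φ p = 0) (hz : FreeOf s z)
    (hs : ∀ j, s j → ∃ (n : ℕ) (c : MvPolynomial σ K), FreeOf s c ∧ z ^ n * X j - c ∈ J)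
    {g : MvPolynomial σ K} (hg : φ g = 0) : g ∈ satIdeal z (J ⊔ N) := by
  obtain ⟨n, c, hc, h⟩ := exists_free_congr hz hs g
  have h1 := hJ _ h
  rw [map_sub, map_mul, hg, mul_zero, zero_sub, neg_eq_zero, FreeOf.hom_congr hφχ hc] at h1
  refine ⟨n, ?_⟩
  have := (J ⊔ N).add_mem (Ideal.mem_sup_left h) (Ideal.mem_sup_right (hχ c h1))
  rwa [sub_add_cancel] at this

/-- Three of the principal `3`-minors. -/
noncomputable abbrev tripleIdeal (K : Type v) [Field K] : Ideal (MvPolynomial (Fin 4 × Fin 4) K) :=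
  Ideal.ofList [minorThree 0 1 3 0 1 3, minorThree 0 2 3 0 2 3, minorThree 1 2 3 1 2 3]

theorem tripleIdeal_le : tripleIdeal K ≤ principalIdeal K := by
  rw [principalIdeal, Ideal.ofList_cons]; exact le_sup_right

theorem exists_free_of_tripleIdeal (j : Fin 4 × Fin 4)
    (hj : j = (0, 0) ∨ j = (1, 1) ∨ j = (1, 0)) :
    ∃ (n : ℕ) (c : MvPolynomial (Fin 4 × Fin 4) K),
      FreeOf (fun j => j = (0, 0) ∨ j = (1, 1) ∨ j = (1, 0)) c ∧
        (minorTwo 2 3 2 3 * minorTwo 0 3 1 3) ^ n * X j - c ∈ tripleIdeal K := by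
  rcases hj with rfl | rfl | rfl
  · refine ⟨1, minorTwo 0 3 1 3 * (X (0, 2) * minorTwo 2 3 0 3 - X (0, 3) * minorTwo 2 3 0 2),
      by simp [FreeOf, minorTwo],
      Ideal.mem_ofList_of_eq [0, minorTwo 0 3 1 3, 0] ?_⟩
    simp only [List.zipWith_cons_cons, List.zipWith_nil_right, List.sum_cons, List.sum_nil,
      minorTwo, minorThree]
    ring
  · refine ⟨1, minorTwo 0 3 1 3 * (X (1, 2) * minorTwo 2 3 1 3 - X (1, 3) * minorTwo 2 3 1 2),
      by simp [FreeOf, minorTwo],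
      Ideal.mem_ofList_of_eq [0, 0, minorTwo 0 3 1 3] ?_⟩
    simp only [List.zipWith_cons_cons, List.zipWith_nil_right, List.sum_cons, List.sum_nil,
      minorTwo, minorThree]
    ring
  · refine ⟨2, minorTwo 2 3 2 3 * minorTwo 0 3 1 3 ^ 2 *
        (X (1, 2) * minorTwo 2 3 0 3 - X (1, 3) * minorTwo 2 3 0 2) -
        minorTwo 0 3 1 3 * (minorTwo 1 3 2 3 * minorTwo 2 3 0 3 * minorThree 0 2 3 1 2 3),
      by simp [FreeOf, minorTwo, minorThree],
      Ideal.mem_ofList_of_eq [-minorTwo 0 3 1 3 * minorTwo 2 3 2 3 ^ 2,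
        minorTwo 0 3 1 3 *
          (X (3, 3) * X (1, 1) * minorTwo 2 3 2 3 - X (1, 3) * X (3, 1) * minorTwo 2 3 2 3),
        minorTwo 0 3 1 3 *
          (X (3, 3) * (X (0, 2) * minorTwo 2 3 0 3 - X (0, 3) * minorTwo 2 3 0 2) -
          X (0, 3) * X (3, 0) * minorTwo 2 3 2 3)] ?_⟩
    simp only [List.zipWith_cons_cons, List.zipWith_nil_right, List.sum_cons, List.sum_nil]
    have h : minorThree (K := K) 1 2 3 0 2 3 = X (1, 0) * minorTwo 2 3 2 3 -
      (X (1, 2) * minorTwo 2 3 0 3 - X (1, 3) * minorTwo 2 3 0 2) := by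
      simp only [minorTwo, minorThree]; ring
    linear_combination minorTwo 0 3 1 3 * eliminate_two K -
      minorTwo 2 3 2 3 * minorTwo 0 3 1 3 ^ 2 * h

/-- The substitution solving the principal `3`-minors for `x₀₀`, `x₁₁` and `x₁₀`. -/
theorem exists_substitution :
    ∃ (F : Type v) (_ : Field F) (_ : Algebra K F) (φ χ : MvPolynomial (Fin 4 × Fin 4) K →ₐ[K] F),
      (∀ j, ¬ (j = (0, 0) ∨ j = (1, 1) ∨ j = (1, 0)) → φ (X j) = χ (X j)) ∧
      (∀ p, χ p = 0 → p ∈ Ideal.ofList [eliminant K]) ∧ (∀ p ∈ principalIdeal K, φ p = 0) := by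
  obtain ⟨F, _, _, χ, hχ⟩ := exists_algHom_field (isPrime_eliminant K)
  have hM : χ (minorTwo 2 3 2 3) ≠ 0 := mt (hχ _).1
    (not_mem_of_eval !![0, 1, 0, 0; 0, 1, 1, 0; 0, 1, 1, 0; 0, 0, 0, 1]
      (by simp [minorTwo, eliminant]) (by simp [minorTwo]))
  have hy : χ (minorTwo 0 3 1 3) ≠ 0 := mt (hχ _).1
    (not_mem_of_eval !![0, 1, 0, 0; 0, 1, 1, 0; 0, 1, 1, 0; 0, 0, 0, 1]
      (by simp [minorTwo, eliminant]) (by simp [minorTwo]))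
  have hw : χ (eliminant K) = 0 := (hχ _).2 (Ideal.mem_ofList_of_mem (by simp))
  let v00 := χ (X (0, 2) * minorTwo 2 3 0 3 - X (0, 3) * minorTwo 2 3 0 2) / χ (minorTwo 2 3 2 3)
  let v11 := χ (X (1, 2) * minorTwo 2 3 1 3 - X (1, 3) * minorTwo 2 3 1 2) / χ (minorTwo 2 3 2 3)
  let v10 := χ (X (1, 2) * minorTwo 2 3 0 3 - X (1, 3) * minorTwo 2 3 0 2) / χ (minorTwo 2 3 2 3) -
    χ (minorTwo 1 3 2 3 * minorTwo 2 3 0 3 * minorThree 0 2 3 1 2 3) /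
      (χ (minorTwo 2 3 2 3) ^ 2 * χ (minorTwo 0 3 1 3))
  let φ : MvPolynomial (Fin 4 × Fin 4) K →ₐ[K] F := aeval fun j =>
    if j = (0, 0) then v00 else if j = (1, 1) then v11 else if j = (1, 0) then v10 else χ (X j)
  have hφχ : ∀ j, ¬ (j = (0, 0) ∨ j = (1, 1) ∨ j = (1, 0)) → φ (X j) = χ (X j) := by
    intro j hj
    simp only [not_or] at hj
    simp [φ, hj.1, hj.2.1, hj.2.2]
  have h : ∀ {p}, FreeOf (fun j => j = (0, 0) ∨ j = (1, 1) ∨ j = (1, 0)) p → φ p = χ p :=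
    fun hp => FreeOf.hom_congr hφχ hp
  have h00 : φ (X (0, 0)) = v00 := by simp [φ]
  have h11 : φ (X (1, 1)) = v11 := by simp [φ]
  have h10 : φ (X (1, 0)) = v10 := by simp [φ]
  have e1 : minorThree (K := K) 0 2 3 0 2 3 = X (0, 0) * minorTwo 2 3 2 3 -
      (X (0, 2) * minorTwo 2 3 0 3 - X (0, 3) * minorTwo 2 3 0 2) := by
    simp only [minorTwo, minorThree]; ring
  have e0 : minorThree (K := K) 1 2 3 1 2 3 = X (1, 1) * minorTwo 2 3 2 3 -
      (X (1, 2) * minorTwo 2 3 1 3 - X (1, 3) * minorTwo 2 3 1 2) := by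
    simp only [minorTwo, minorThree]; ring
  have e : minorThree (K := K) 1 2 3 0 2 3 = X (1, 0) * minorTwo 2 3 2 3 -
      (X (1, 2) * minorTwo 2 3 0 3 - X (1, 3) * minorTwo 2 3 0 2) := by
    simp only [minorTwo, minorThree]; ring
  have hφM : φ (minorTwo 2 3 2 3) = χ (minorTwo 2 3 2 3) := h (by simp [FreeOf, minorTwo])
  have p1 : φ (minorThree 0 2 3 0 2 3) = 0 := by
    rw [e1, map_sub, map_mul, h00, hφM,
      h (p := X (0, 2) * minorTwo 2 3 0 3 - _) (by simp [FreeOf, minorTwo])]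
    simp only [v00]; field_simp; ring
  have p0 : φ (minorThree 1 2 3 1 2 3) = 0 := by
    rw [e0, map_sub, map_mul, h11, hφM,
      h (p := X (1, 2) * minorTwo 2 3 1 3 - _) (by simp [FreeOf, minorTwo])]
    simp only [v11]; field_simp; ring
  have m10 : χ (minorTwo 2 3 2 3) * χ (minorTwo 0 3 1 3) * φ (minorThree 1 2 3 0 2 3) =
      -χ (minorTwo 1 3 2 3 * minorTwo 2 3 0 3 * minorThree 0 2 3 1 2 3) := by
    rw [e, map_sub, map_mul, h10, hφM,
      h (p := X (1, 2) * minorTwo 2 3 0 3 - _) (by simp [FreeOf, minorTwo])]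
    simp only [v10]; field_simp; ring
  have hy' : φ (minorTwo 0 3 1 3) = χ (minorTwo 0 3 1 3) := h (by simp [FreeOf, minorTwo])
  have hy4 : φ (minorTwo 0 2 1 2) = χ (minorTwo 0 2 1 2) := h (by simp [FreeOf, minorTwo])
  have hg : φ (minorTwo 1 3 2 3 * minorTwo 2 3 0 3 * minorThree 0 2 3 1 2 3) =
      χ (minorTwo 1 3 2 3 * minorTwo 2 3 0 3 * minorThree 0 2 3 1 2 3) :=
    h (by simp [FreeOf, minorTwo, minorThree])
  have ha : φ (minorTwo 1 2 2 3 * minorTwo 2 3 0 2 * minorThree 0 2 3 1 2 3) =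
      χ (minorTwo 1 2 2 3 * minorTwo 2 3 0 2 * minorThree 0 2 3 1 2 3) :=
    h (by simp [FreeOf, minorTwo, minorThree])
  have p2 : φ (minorThree 0 1 3 0 1 3) = 0 := by
    have h2 := congrArg φ (eliminate_two K)
    simp only [map_add, map_mul _ (minorTwo 2 3 2 3 ^ 2), map_mul _ (minorTwo 2 3 2 3 * _),
      map_mul _ _ (minorThree 1 2 3 1 2 3), map_mul _ _ (minorThree 0 2 3 0 2 3), p0, p1, hg,
      mul_zero, add_zero, map_pow, map_mul _ (minorTwo 2 3 2 3), hφM, hy', m10] at h2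
    refine (mul_eq_zero.1 (?_ : χ (minorTwo 2 3 2 3) ^ 2 * _ = 0)).resolve_left (pow_ne_zero 2 hM)
    linear_combination h2
  have p3 : φ (minorThree 0 1 2 0 1 2) = 0 := by
    have h2 := congrArg φ (eliminate_three K)
    simp only [map_add, map_mul _ (minorTwo 2 3 2 3 ^ 2), map_mul _ (minorTwo 2 3 2 3 * _),
      map_mul _ _ (minorThree 1 2 3 1 2 3), map_mul _ _ (minorThree 0 2 3 0 2 3), p0, p1, ha,
      mul_zero, add_zero, map_pow, map_mul _ (minorTwo 2 3 2 3), hφM, hy4] at h2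
    refine (mul_eq_zero.1 (?_ : χ (minorTwo 2 3 2 3) ^ 2 * χ (minorTwo 0 3 1 3) * _ = 0)).resolve_left
      (mul_ne_zero (pow_ne_zero 2 hM) hy)
    simp only [eliminant, map_sub, map_mul] at hw h2 m10
    linear_combination χ (minorTwo 0 3 1 3) * h2 - χ (minorTwo 0 2 1 2) * m10 +
      χ (minorThree 0 2 3 1 2 3) * hw
  refine ⟨F, inferInstance, inferInstance, φ, χ, hφχ, fun p => (hχ p).1, fun p hp => ?_⟩
  refine (Ideal.ofList_le (I := RingHom.ker φ) ?_) hp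
  simp [p0, p1, p2, p3]

theorem mul_mem_satIdeal_of_minorFour {q a : MvPolynomial (Fin 4 × Fin 4) K} {k : ℕ}
    (hq : minorFour K ^ k * q ∈ principalIdeal K) (ha : a ∈ minorIdeal K) :
    q * a ∈ satIdeal (minorTwo 2 3 2 3 * minorTwo 0 3 1 3) (principalIdeal K) := by
  obtain ⟨F, _, _, φ, χ, hφχ, hχ, hφ⟩ := exists_substitution (K := K)
  have hker : ∀ {g}, φ g = 0 → g ∈ satIdeal (minorTwo 2 3 2 3 * minorTwo 0 3 1 3)
      (tripleIdeal K ⊔ Ideal.ofList [eliminant K]) := fun hg =>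
    mem_satIdeal_of_hom hφχ hχ (fun p hp => hφ p (tripleIdeal_le hp))
      (by simp [FreeOf, minorTwo]) exists_free_of_tripleIdeal hg
  have hΔ : φ (minorFour K) ≠ 0 := by
    intro h
    obtain ⟨n, hn⟩ := hker h
    rw [← Ideal.ofList_append] at hn
    revert hn
    exact not_mem_of_eval !![0, -1, 0, 0; 0, 0, 0, 1; -1, 0, -1, 0; 0, 0, 1, 1]
      (by simp [minorTwo, minorThree, eliminant]) (by simp [minorTwo, minorThree, minorFour])
  have hq' : φ q = 0 := by
    have h := hφ _ hq
    rw [map_mul, map_pow] at h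
    exact (mul_eq_zero.1 h).resolve_left (pow_ne_zero k hΔ)
  refine mem_satIdeal_mul (hker hq') (B := tripleIdeal K ⊔ Ideal.ofList [minorThree 0 2 3 1 2 3])
    (minors_le_satIdeal (fun _ => mem_satIdeal_of_mul_left) (fun _ => mem_satIdeal_of_mul_right)
      ?_ ?_ ?_ ?_ ha) ?_
  iterate 3 exact le_satIdeal _ _ (Ideal.mem_sup_left (Ideal.mem_ofList_of_mem (by simp)))
  · exact le_satIdeal _ _ (Ideal.mem_sup_right (Ideal.mem_ofList_of_mem (by simp)))
  · rw [Ideal.sup_mul]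
    refine sup_le (Ideal.mul_le_left.trans tripleIdeal_le) ?_
    rw [Ideal.mul_sup, Ideal.ofList_singleton, Ideal.ofList_singleton,
      Ideal.span_singleton_mul_span_singleton]
    refine sup_le (Ideal.mul_le_right.trans tripleIdeal_le)
      ((Ideal.span_singleton_le_iff_mem _).2 ?_)
    rw [mul_comm]
    exact minorThree_mul_eliminant_mem
end

section
section comm
variable {R : Type*} [CommRing R]

/-- If `a, b` is a regular sequence modulo `l`, then `a` is regular modulo `b, l`. -/
theorem RegularMod.swap {a b : R} {l : List R} (ha : RegularMod a (Ideal.ofList l))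
    (hb : RegularMod b (Ideal.ofList (a :: l))) : RegularMod a (Ideal.ofList (b :: l)) := by
  intro t ht
  obtain ⟨c, hc⟩ := Ideal.mem_ofList_cons.1 ht
  obtain ⟨e, he⟩ := Ideal.mem_ofList_cons.1 (hb c (Ideal.mem_ofList_cons.2 ⟨t, by
    convert neg_mem hc using 1; ring⟩))
  refine Ideal.mem_ofList_cons.2 ⟨e, ha _ ?_⟩
  convert add_mem hc (Ideal.mul_mem_left _ b he) using 1
  ring

theorem RegularMod.pow {a : R} {I : Ideal R} (ha : RegularMod a I) (n : ℕ) :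
    RegularMod (a ^ n) I := by
  induction n with
  | zero => intro t ht; simpa using ht
  | succ n ih => intro t ht; exact ha t (ih _ (by rwa [← mul_assoc, ← pow_succ]))

theorem RegularMod.of_neg {a b : R} {I : Ideal R} (ha : RegularMod a I) (h : b = -a) :
    RegularMod b I := fun t ht => ha t (by
  convert neg_mem ht using 1
  rw [h]; ring)

/-- If `W` contains every element which all members of `l` multiply into `W`, then it contains
every element which powers of all members of `l` multiply into `W`. -/
theorem mem_of_forall_pow_mul_mem {W : Ideal R} {l : List R}
    (h : ∀ b, (∀ t ∈ l, t * b ∈ W) → b ∈ W) {b : R} (hb : ∀ t ∈ l, ∃ n : ℕ, t ^ n * b ∈ W) :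
    b ∈ W := by
  have hfg : (Ideal.ofList l).FG := ⟨by classical exact l.toFinset, by simp [Ideal.ofList]⟩
  obtain ⟨N, hN⟩ := Ideal.exists_pow_le_of_le_radical_of_fg (J := W.colon {b})
    (Ideal.ofList_le (l := l) fun t ht => by
      obtain ⟨n, hn⟩ := hb t ht
      exact ⟨n, Submodule.mem_colon_singleton.2 hn⟩) hfg
  have key : ∀ (N : ℕ) (b : R), (∀ x ∈ Ideal.ofList l ^ N, x * b ∈ W) → b ∈ W := by
    intro N
    induction N with
    | zero => intro b h; simpa using h 1 (by simp)
    | succ N ih =>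
      intro b hb
      refine h b fun t ht => ih _ fun x hx => ?_
      rw [← mul_assoc]
      exact hb _ (by rw [pow_succ]; exact Ideal.mul_mem_mul hx (Ideal.mem_ofList_of_mem ht))
  exact key N b fun x hx => Submodule.mem_colon_singleton.1 (hN hx)
end comm

open MvPolynomial
universe v
variable {K : Type v} [Field K]

theorem isPrime_minorTwo_zero_three : (Ideal.ofList [minorTwo 0 3 1 3 (K := K)]).IsPrime :=
  isPrime_cons_minorTwo isPrime_ofList_nil (by decide) (by decide) (by simp)
    (not_mem_of_eval (fun _ _ => 1) (by simp) (by simp))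

/-- An element free of `x₀₀` and `x₁₁` of the ideal of two principal `3`-minors vanishes. -/
theorem eq_zero_of_free {c : MvPolynomial (Fin 4 × Fin 4) K}
    (hc : FreeOf (fun j => j = (0, 0) ∨ j = (1, 1)) c)
    (h : c ∈ Ideal.ofList [minorThree 0 2 3 0 2 3, minorThree 1 2 3 1 2 3]) : c = 0 := by
  obtain ⟨F, _, _, χ, hχ⟩ := exists_algHom_field (isPrime_ofList_nil (K := K) (σ := Fin 4 × Fin 4))
  have hM : χ (minorTwo 2 3 2 3) ≠ 0 := mt (hχ _).1
    (not_mem_of_eval !![0, 0, 0, 0; 0, 0, 0, 0; 0, 0, 1, 0; 0, 0, 0, 1] (by simp)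
      (by simp [minorTwo]))
  let v00 := χ (X (0, 2) * minorTwo 2 3 0 3 - X (0, 3) * minorTwo 2 3 0 2) / χ (minorTwo 2 3 2 3)
  let v11 := χ (X (1, 2) * minorTwo 2 3 1 3 - X (1, 3) * minorTwo 2 3 1 2) / χ (minorTwo 2 3 2 3)
  let φ : MvPolynomial (Fin 4 × Fin 4) K →ₐ[K] F := aeval fun j =>
    if j = (0, 0) then v00 else if j = (1, 1) then v11 else χ (X j)
  have hφ : ∀ {p}, FreeOf (fun j => j = (0, 0) ∨ j = (1, 1)) p → φ p = χ p :=
    fun hp => FreeOf.hom_congr (fun j hj => by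
      simp only [not_or] at hj
      simp [φ, hj.1, hj.2]) hp
  have h00 : φ (X (0, 0)) = v00 := by simp [φ]
  have h11 : φ (X (1, 1)) = v11 := by simp [φ]
  have hφM : φ (minorTwo 2 3 2 3) = χ (minorTwo 2 3 2 3) := hφ (by simp [FreeOf, minorTwo])
  have e1 : minorThree (K := K) 0 2 3 0 2 3 = X (0, 0) * minorTwo 2 3 2 3 -
      (X (0, 2) * minorTwo 2 3 0 3 - X (0, 3) * minorTwo 2 3 0 2) := by
    simp only [minorTwo, minorThree]; ring
  have e0 : minorThree (K := K) 1 2 3 1 2 3 = X (1, 1) * minorTwo 2 3 2 3 -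
      (X (1, 2) * minorTwo 2 3 1 3 - X (1, 3) * minorTwo 2 3 1 2) := by
    simp only [minorTwo, minorThree]; ring
  have p1 : φ (minorThree 0 2 3 0 2 3) = 0 := by
    rw [e1, map_sub, map_mul, h00, hφM,
      hφ (p := X (0, 2) * minorTwo 2 3 0 3 - _) (by simp [FreeOf, minorTwo])]
    simp only [v00]; field_simp; ring
  have p0 : φ (minorThree 1 2 3 1 2 3) = 0 := by
    rw [e0, map_sub, map_mul, h11, hφM,
      hφ (p := X (1, 2) * minorTwo 2 3 1 3 - _) (by simp [FreeOf, minorTwo])]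
    simp only [v11]; field_simp; ring
  have h0 : φ c = 0 := Ideal.ofList_le (I := RingHom.ker φ) (by simp [p0, p1]) h
  simpa [Ideal.ofList_nil] using (hχ c).1 ((hφ hc).symm.trans h0)

/-- The minor `[2 3 | 2 3]` and `[1 3 | 0 3]` are regular modulo the two remaining factors of
the eliminated principal minor. -/
theorem regularMod_reduced {t : MvPolynomial (Fin 4 × Fin 4) K}
    (ht : t = minorTwo 2 3 2 3 ∨ t = minorTwo 1 3 0 3) :
    RegularMod t (Ideal.ofList [minorTwo 1 3 2 3 * minorTwo 2 3 0 3 * minorThree 0 2 3 1 2 3,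
      minorTwo 0 3 1 3]) := by
  have hy := isPrime_minorTwo_zero_three (K := K)
  rcases ht with rfl | rfl
  · refine RegularMod.of_neg (a := minorTwo 2 3 3 2) (.swap (hy.regularMod ?_)
      ((isPrime_cons_minorTwo hy (by decide) (by decide) (by simp [FreeOf, minorTwo])
        ?_).regularMod ?_)) (by simp only [minorTwo]; ring)
    · exact not_mem_of_eval !![0, 0, 0, 1; 0, 0, 1, 0; 0, 0, 1, 0; 0, 0, 0, 1]
        (by simp [minorTwo]) (by simp [minorTwo])
    · exact not_mem_of_eval !![0, 0, 0, 1; 0, 0, 1, 0; 0, 0, 1, 0; 0, 0, 0, 1]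
        (by simp [minorTwo]) (by simp)
    · exact not_mem_of_eval !![0, 0, 1, 0; 0, 0, 1, 0; 1, 1, 0, 0; 0, 1, 0, 1]
        (by simp [minorTwo]) (by simp [minorTwo, minorThree])
  · refine RegularMod.of_neg (a := minorTwo 1 3 3 0) (.swap (hy.regularMod ?_)
      ((isPrime_cons_minorTwo hy (by decide) (by decide) (by simp [FreeOf, minorTwo])
        ?_).regularMod ?_)) (by simp only [minorTwo]; ring)
    · exact not_mem_of_eval !![0, 0, 0, 0; 1, 1, 0, 0; 1, 1, 0, 0; 0, 0, 0, 1]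
        (by simp [minorTwo]) (by simp [minorTwo])
    · exact not_mem_of_eval !![0, 0, 0, 0; 1, 1, 0, 0; 1, 1, 0, 0; 0, 0, 0, 1]
        (by simp [minorTwo]) (by simp)
    · exact not_mem_of_eval !![1, 0, 1, 0; 0, 0, 1, 0; 1, 1, 0, 0; 0, 0, 0, 1]
        (by simp [minorTwo]) (by simp [minorTwo, minorThree])

theorem exists_free_of_pair (g : MvPolynomial (Fin 4 × Fin 4) K) :
    ∃ (n : ℕ) (c : MvPolynomial (Fin 4 × Fin 4) K),
      FreeOf (fun j => j = (0, 0) ∨ j = (1, 1)) c ∧ minorTwo 2 3 2 3 ^ n * g - c ∈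
        Ideal.ofList [minorThree 0 2 3 0 2 3, minorThree 1 2 3 1 2 3] := by
  refine exists_free_congr (by simp [FreeOf, minorTwo]) (fun j hj => ?_) g
  rcases hj with rfl | rfl
  · refine ⟨1, X (0, 2) * minorTwo 2 3 0 3 - X (0, 3) * minorTwo 2 3 0 2,
      by simp [FreeOf, minorTwo], Ideal.mem_ofList_of_eq [1, 0] ?_⟩
    simp only [List.zipWith_cons_cons, List.zipWith_nil_right, List.sum_cons, List.sum_nil,
      minorTwo, minorThree]
    ring
  · refine ⟨1, X (1, 2) * minorTwo 2 3 1 3 - X (1, 3) * minorTwo 2 3 1 2,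
      by simp [FreeOf, minorTwo], Ideal.mem_ofList_of_eq [0, 1] ?_⟩
    simp only [List.zipWith_cons_cons, List.zipWith_nil_right, List.sum_cons, List.sum_nil,
      minorTwo, minorThree]
    ring

/-- Up to powers of `[2 3 | 2 3]`, the minor `[1 3 | 0 3]` is regular modulo `[0 3 | 1 3]` and three
principal `3`-minors. -/
theorem exists_pow_mul_mem {b : MvPolynomial (Fin 4 × Fin 4) K}
    (hb : minorTwo 1 3 0 3 * b ∈ Ideal.ofList [minorTwo 0 3 1 3, minorThree 0 1 3 0 1 3,
      minorThree 0 2 3 0 2 3, minorThree 1 2 3 1 2 3]) :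
    ∃ n : ℕ, minorTwo 2 3 2 3 ^ n * b ∈ Ideal.ofList [minorTwo 0 3 1 3, minorThree 0 1 3 0 1 3,
      minorThree 0 2 3 0 2 3, minorThree 1 2 3 1 2 3] := by
  set J := Ideal.ofList [minorThree (K := K) 0 2 3 0 2 3, minorThree 1 2 3 1 2 3] with hJ
  set L := Ideal.ofList [minorTwo (K := K) 0 3 1 3, minorThree 0 1 3 0 1 3,
      minorThree 0 2 3 0 2 3, minorThree 1 2 3 1 2 3] with hL
  have hJL : J ≤ L := by
    rw [hL, Ideal.ofList_cons, Ideal.ofList_cons]; exact le_sup_of_le_right le_sup_right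
  have hred : minorTwo 2 3 2 3 ^ 2 * minorThree 0 1 3 0 1 3 +
      minorTwo 2 3 2 3 * minorTwo 0 3 1 3 * minorThree 1 2 3 0 2 3 +
      minorTwo 1 3 2 3 * minorTwo 2 3 0 3 * minorThree 0 2 3 1 2 3 ∈ J := by
    rw [eliminate_two]
    exact J.add_mem (J.mul_mem_left _ (Ideal.mem_ofList_of_mem (by simp)))
      (J.mul_mem_left _ (Ideal.mem_ofList_of_mem (by simp)))
  have hgL : minorTwo 1 3 2 3 * minorTwo 2 3 0 3 * minorThree 0 2 3 1 2 3 ∈ L := by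
    refine (L.add_mem_iff_right ?_).1 (hJL hred)
    exact L.add_mem (L.mul_mem_left _ (Ideal.mem_ofList_of_mem (by simp)))
      (L.mul_mem_right _ (L.mul_mem_left _ (Ideal.mem_ofList_of_mem (by simp))))
  obtain ⟨α, hα⟩ := Ideal.mem_ofList_cons.1 hb
  obtain ⟨β, hβ⟩ := Ideal.mem_ofList_cons.1 hα
  obtain ⟨n, c, hc, hbc⟩ := exists_free_of_pair b
  obtain ⟨k, α', hα', hkα⟩ := exists_free_of_pair
    (minorTwo 2 3 2 3 ^ 2 * α - minorTwo 2 3 2 3 * minorThree 1 2 3 0 2 3 * β)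
  obtain ⟨m, β', hβ', hmβ⟩ := exists_free_of_pair β
  set M := minorTwo (K := K) 2 3 2 3
  set G := minorTwo (K := K) 1 3 2 3 * minorTwo 2 3 0 3 * minorThree 0 2 3 1 2 3
  have hM : FreeOf (fun j => j = (0, 0) ∨ j = (1, 1)) M := by simp [FreeOf, minorTwo, M]
  have hG : FreeOf (fun j => j = (0, 0) ∨ j = (1, 1)) G := by
    simp [FreeOf, minorTwo, minorThree, G]
  have hy1 : FreeOf (fun j => j = (0, 0) ∨ j = (1, 1)) (minorTwo (K := K) 0 3 1 3) := by
    simp [FreeOf, minorTwo]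
  have hy2 : FreeOf (fun j => j = (0, 0) ∨ j = (1, 1)) (minorTwo (K := K) 1 3 0 3) := by
    simp [FreeOf, minorTwo]
  have heq : M ^ (k + m + 2) * (minorTwo 1 3 0 3 * c) - M ^ (m + n) * α' * minorTwo 0 3 1 3 +
      M ^ (k + n) * β' * G = 0 := by
    refine eq_zero_of_free (((((hM.pow _).mul (hy2.mul hc)).sub (((hM.pow _).mul hα').mul hy1))).add
      (((hM.pow _).mul hβ').mul hG)) ?_
    have h := J.add_mem (J.add_mem (J.mul_mem_left (M ^ (k + m + 2 + n)) hβ)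
      (J.mul_mem_left (M ^ (k + m + n) * β) hred)) (J.add_mem
      (J.mul_mem_left (-(M ^ (k + m + 2) * minorTwo 1 3 0 3)) hbc) (J.add_mem
      (J.mul_mem_left (M ^ (m + n) * minorTwo 0 3 1 3) hkα)
      (J.mul_mem_left (-(M ^ (k + n) * G)) hmβ)))
    convert h using 1
    ring
  have hc' : c ∈ Ideal.ofList [G, minorTwo 0 3 1 3] := by
    refine regularMod_reduced (.inr rfl) _ ((regularMod_reduced (.inl rfl)).pow (k + m + 2) _
      (Ideal.mem_ofList_of_eq [-(M ^ (k + n) * β'), M ^ (m + n) * α'] ?_))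
    simp only [List.zipWith_cons_cons, List.zipWith_nil_right, List.sum_cons, List.sum_nil]
    linear_combination heq
  refine ⟨n, ?_⟩
  have hcL : c ∈ L := Ideal.ofList_le (by
    simp only [List.forall_mem_cons]
    exact ⟨hgL, Ideal.mem_ofList_of_mem (by simp), fun _ h => (List.not_mem_nil h).elim⟩) hc'
  simpa using L.add_mem (hJL hbc) hcL

theorem mem_satIdeal_of_minorTwo_mul {b : MvPolynomial (Fin 4 × Fin 4) K}
    (h1 : minorTwo 0 3 1 3 * b ∈ satIdeal (minorTwo 2 3 2 3) (principalIdeal K))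
    (h2 : minorTwo 1 3 0 3 * b ∈ satIdeal (minorTwo 2 3 2 3) (principalIdeal K)) :
    b ∈ satIdeal (minorTwo 2 3 2 3) (principalIdeal K) := by
  obtain ⟨n, hn⟩ := h1
  obtain ⟨m, hm⟩ := h2
  have J := isPrime_minor_two_one_zero (K := K)
  obtain ⟨b', hb', hb⟩ := exists_exchange (p := minorThree 0 1 2 0 1 2) (z := minorTwo 0 3 1 3)
    (T := {minorTwo 0 3 1 3, minorTwo 1 3 0 3}) (b := minorTwo 2 3 2 3 ^ (n + m) * b)
    (J.regularMod (not_mem_of_eval !![0, 1, 0, 0; 0, 0, 1, 0; 1, 0, 0, 0; 0, 0, 0, 1]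
      (by simp [minorTwo, minorThree]) (by simp [minorTwo, minorThree])))
    (J.regularMod (not_mem_of_eval !![0, 1, 0, 0; 0, 0, 1, 0; 1, 0, 0, 0; 0, 0, 0, 1]
      (by simp [minorTwo, minorThree]) (by simp [minorTwo]))) (by simp) (by
      rintro t (rfl | rfl)
      · change _ ∈ principalIdeal K
        convert Ideal.mul_mem_left _ (minorTwo 2 3 2 3 ^ m) hn using 1
        ring
      · change _ ∈ principalIdeal K
        convert Ideal.mul_mem_left _ (minorTwo 2 3 2 3 ^ n) hm using 1
        ring)
  obtain ⟨k, hk⟩ := exists_pow_mul_mem (hb' _ (.inr rfl))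
  refine ⟨k + (n + m), ?_⟩
  rw [pow_add, mul_assoc]
  exact hb _ hk
end

section
open MvPolynomial
universe v
variable (K : Type v) [Field K]

theorem det_genMat_submatrix (f g : Fin 3 → Fin 4) :
    ((genMat K 4).submatrix f g).det = minorThree (f 0) (f 1) (f 2) (g 0) (g 1) (g 2) := by
  rw [Matrix.det_fin_three]
  simp only [Matrix.submatrix_apply, genMat, minorThree, minorTwo]
  ring

theorem det_genMat : (genMat K 4).det = minorFour K := by
  rw [Matrix.det_succ_row_zero, Fin.sum_univ_four]
  simp only [det_genMat_submatrix]
  simp [genMat, minorFour, Fin.succAbove]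
  ring

theorem exists_orderIsoOfFin_comp {f : Fin 3 → Fin 4} (hf : f.Injective) :
    ∃ (s : Finset (Fin 4)) (hs : s.card = 3) (σ : Equiv.Perm (Fin 3)),
      ∀ i, f i = s.orderIsoOfFin hs (σ i) := by
  have hs : (Finset.univ.image f).card = 3 := by
    rw [Finset.card_image_of_injective _ hf, Finset.card_univ, Fintype.card_fin]
  have hmem : ∀ i, f i ∈ Finset.univ.image f := fun i => Finset.mem_image_of_mem f (Finset.mem_univ i)
  refine ⟨_, hs, Equiv.ofBijective
    (fun i => ((Finset.univ.image f).orderIsoOfFin hs).symm ⟨f i, hmem i⟩)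
    (Finite.injective_iff_bijective.1 fun i j h => ?_), fun i => ?_⟩
  · exact hf (congrArg Subtype.val ((OrderIso.injective _) h))
  · simp

theorem minorThree_mem_detIdeal (a b c d e f : Fin 4) :
    minorThree a b c d e f ∈ detIdeal K 4 3 := by
  have h := det_genMat_submatrix K ![a, b, c] ![d, e, f]
  simp only [Matrix.cons_val] at h
  rw [← h]
  by_cases hf : (![a, b, c] : Fin 3 → Fin 4).Injective
  swap
  · simp only [Function.Injective, not_forall] at hf
    obtain ⟨i, j, hij, hne⟩ := hf
    rw [Matrix.det_zero_of_row_eq hne (by ext k; simp only [Matrix.submatrix_apply, hij])]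
    exact zero_mem _
  by_cases hg : (![d, e, f] : Fin 3 → Fin 4).Injective
  swap
  · simp only [Function.Injective, not_forall] at hg
    obtain ⟨i, j, hij, hne⟩ := hg
    rw [Matrix.det_zero_of_column_eq hne (fun k => by simp only [Matrix.submatrix_apply, hij])]
    exact zero_mem _
  obtain ⟨s, hs, σ, hσ⟩ := exists_orderIsoOfFin_comp hf
  obtain ⟨t, ht, τ, hτ⟩ := exists_orderIsoOfFin_comp hg
  set A : Matrix (Fin 3) (Fin 3) (MvPolynomial (Fin 4 × Fin 4) K) :=
    Matrix.of fun i j => genMat K 4 (s.orderIsoOfFin hs i) (t.orderIsoOfFin ht j) with hA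
  have : (genMat K 4).submatrix ![a, b, c] ![d, e, f] = (A.submatrix σ id).submatrix id τ := by
    ext1 i j
    simp only [Matrix.submatrix_apply, hA, Matrix.of_apply, hσ, hτ, id]
  rw [this, Matrix.det_permute', Matrix.det_permute]
  exact Ideal.mul_mem_left _ _ (Ideal.mul_mem_left _ _ (Ideal.subset_span ⟨s, t, hs, ht, rfl⟩))

theorem det_subtype_eq {s : Finset (Fin 4)} (e : Fin 3 ≃ {x // x ∈ s}) :
    ((genMat K 4).submatrix (fun i : {x // x ∈ s} => (i : Fin 4))
      (fun j : {x // x ∈ s} => (j : Fin 4))).det =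
      minorThree (e 0) (e 1) (e 2) (e 0) (e 1) (e 2 : Fin 4) := by
  rw [← Matrix.det_submatrix_equiv_self e, Matrix.submatrix_submatrix, det_genMat_submatrix]
  rfl

theorem minorThree_mem_prinMinorIdeal (a b c : Fin 4) :
    minorThree a b c a b c ∈ prinMinorIdeal K 4 3 := by
  by_cases hf : (![a, b, c] : Fin 3 → Fin 4).Injective
  · obtain ⟨s, hs, σ, hσ⟩ := exists_orderIsoOfFin_comp hf
    have h := det_subtype_eq K (σ.trans (s.orderIsoOfFin hs).toEquiv)
    simp only [Equiv.trans_apply, OrderIso.coe_toEquiv, ← hσ, Matrix.cons_val] at h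
    exact Ideal.subset_span ⟨s, hs, h.symm⟩
  · have h := det_genMat_submatrix K ![a, b, c] ![a, b, c]
    simp only [Matrix.cons_val] at h
    rw [← h]
    simp only [Function.Injective, not_forall] at hf
    obtain ⟨i, j, hij, hne⟩ := hf
    rw [Matrix.det_zero_of_row_eq hne (by ext k; simp only [Matrix.submatrix_apply, hij])]
    exact zero_mem _

theorem eq_of_lt_of_lt {a b c : Fin 4} (hab : a < b) (hbc : b < c) :
    (a = 0 ∧ b = 1 ∧ c = 2) ∨ (a = 0 ∧ b = 1 ∧ c = 3) ∨ (a = 0 ∧ b = 2 ∧ c = 3) ∨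
      (a = 1 ∧ b = 2 ∧ c = 3) := by
  revert a b c; decide

theorem detIdeal_eq : detIdeal K 4 3 = minorIdeal K := by
  refine le_antisymm (Ideal.span_le.2 ?_) (Ideal.ofList_le ?_)
  · rintro _ ⟨s, t, hs, ht, rfl⟩
    have h := det_genMat_submatrix K (fun i => s.orderIsoOfFin hs i) (fun i => t.orderIsoOfFin ht i)
    have hlt : ∀ {u : Finset (Fin 4)} (hu : u.card = 3) {i j : Fin 3}, i < j →
        (u.orderIsoOfFin hu i : Fin 4) < u.orderIsoOfFin hu j := fun {u} hu _ _ hij =>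
      Subtype.coe_lt_coe.2 ((u.orderIsoOfFin hu).lt_iff_lt.2 hij)
    change det (Matrix.submatrix _ _ _) ∈ minorIdeal K
    rw [h]
    rcases eq_of_lt_of_lt (hlt hs (i := 0) (j := 1) (by decide)) (hlt hs (j := 2) (by decide)) with
      ⟨h1, h2, h3⟩ | ⟨h1, h2, h3⟩ | ⟨h1, h2, h3⟩ | ⟨h1, h2, h3⟩ <;>
    rcases eq_of_lt_of_lt (hlt ht (i := 0) (j := 1) (by decide)) (hlt ht (j := 2) (by decide)) with
      ⟨h4, h5, h6⟩ | ⟨h4, h5, h6⟩ | ⟨h4, h5, h6⟩ | ⟨h4, h5, h6⟩ <;>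
    · rw [h1, h2, h3, h4, h5, h6]
      exact Ideal.mem_ofList_of_mem (by simp)
  · simp only [List.forall_mem_cons]
    simp [minorThree_mem_detIdeal]

theorem prinMinorIdeal_eq : prinMinorIdeal K 4 3 = principalIdeal K := by
  refine le_antisymm (Ideal.span_le.2 ?_) (Ideal.ofList_le ?_)
  · rintro _ ⟨s, hs, rfl⟩
    have hlt : ∀ {i j : Fin 3}, i < j →
        (s.orderIsoOfFin hs i : Fin 4) < s.orderIsoOfFin hs j := fun hij =>
      Subtype.coe_lt_coe.2 ((s.orderIsoOfFin hs).lt_iff_lt.2 hij)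
    rw [det_subtype_eq K (s.orderIsoOfFin hs).toEquiv]
    rcases eq_of_lt_of_lt (hlt (i := 0) (j := 1) (by decide)) (hlt (j := 2) (by decide)) with
      ⟨h1, h2, h3⟩ | ⟨h1, h2, h3⟩ | ⟨h1, h2, h3⟩ | ⟨h1, h2, h3⟩ <;>
    · simp only [RelIso.coe_fn_toEquiv, h1, h2, h3]
      exact Ideal.mem_ofList_of_mem (by simp)
  · simp [minorThree_mem_prinMinorIdeal]

theorem minorThree_mem_minorIdeal (a b c d e f : Fin 4) :
    minorThree a b c d e f ∈ minorIdeal K :=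
  detIdeal_eq K ▸ minorThree_mem_detIdeal K a b c d e f

theorem minorThree_mem_principalIdeal (a b c : Fin 4) :
    minorThree a b c a b c ∈ principalIdeal K :=
  prinMinorIdeal_eq K ▸ minorThree_mem_prinMinorIdeal K a b c

theorem mem_Qideal {q : MvPolynomial (Fin 4 × Fin 4) K} :
    q ∈ Qideal K 4 ↔ ∃ k : ℕ, minorFour K ^ k * q ∈ principalIdeal K := by
  rw [Qideal, Ideal.mem_comap, IsLocalization.algebraMap_mem_map_algebraMap_iff
    (Submonoid.powers (genMat K 4).det), prinMinorIdeal_eq, det_genMat]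
  simp [Submonoid.mem_powers_iff]

end

section
open MvPolynomial
universe v
variable (K : Type v) [Field K]

/-- Simultaneous permutation of the rows and columns of the generic matrix. -/
noncomputable def permute (π : Equiv.Perm (Fin 4)) :
    MvPolynomial (Fin 4 × Fin 4) K →ₐ[K] MvPolynomial (Fin 4 × Fin 4) K :=
  rename (Prod.map π π)

variable {K}

theorem permute_minorTwo (π : Equiv.Perm (Fin 4)) (a b c d : Fin 4) :
    permute K π (minorTwo a b c d) = minorTwo (π a) (π b) (π c) (π d) := by
  simp [permute, minorTwo]

theorem permute_minorThree (π : Equiv.Perm (Fin 4)) (a b c d e f : Fin 4) :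
    permute K π (minorThree a b c d e f) =
      minorThree (π a) (π b) (π c) (π d) (π e) (π f) := by
  simp only [minorThree, map_add, map_sub, map_mul, permute_minorTwo]
  simp [permute]

theorem permute_minorFour (π : Equiv.Perm (Fin 4)) :
    permute K π (minorFour K) = minorFour K := by
  rw [← det_genMat, AlgHom.map_det, ← Matrix.det_submatrix_equiv_self π (genMat K 4)]
  congr 1
  ext1 i j
  simp [permute, genMat]

theorem permute_permute_symm (π : Equiv.Perm (Fin 4)) (g : MvPolynomial (Fin 4 × Fin 4) K) :
    permute K π (permute K π.symm g) = g := by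
  rw [permute, permute, rename_rename, Prod.map_comp_map]
  simp

theorem Ideal.map_mem_of_ofList {R : Type*} [CommRing R] (f : R →+* R) {l : List R} {J : Ideal R}
    (h : ∀ p ∈ l, f p ∈ J) {g : R} (hg : g ∈ Ideal.ofList l) : f g ∈ J :=
  Ideal.mem_comap.1 (Ideal.ofList_le (I := J.comap f) h hg)

theorem permute_mem_principalIdeal (π : Equiv.Perm (Fin 4)) {g : MvPolynomial (Fin 4 × Fin 4) K}
    (hg : g ∈ principalIdeal K) : permute K π g ∈ principalIdeal K := by
  refine Ideal.map_mem_of_ofList (permute K π).toRingHom ?_ hg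
  simp [permute_minorThree, minorThree_mem_principalIdeal]

theorem permute_mem_minorIdeal (π : Equiv.Perm (Fin 4)) {g : MvPolynomial (Fin 4 × Fin 4) K}
    (hg : g ∈ minorIdeal K) : permute K π g ∈ minorIdeal K := by
  refine Ideal.map_mem_of_ofList (permute K π).toRingHom ?_ hg
  simp [permute_minorThree, minorThree_mem_minorIdeal]

/-- A saturation statement about products of elements of `Q₃` and `I₃` transfers along
simultaneous row and column permutations. -/
theorem mul_mem_satIdeal_permute {z : MvPolynomial (Fin 4 × Fin 4) K}
    (h : ∀ {q a : MvPolynomial (Fin 4 × Fin 4) K} {k : ℕ}, minorFour K ^ k * q ∈ principalIdeal K →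
      a ∈ minorIdeal K → q * a ∈ satIdeal z (principalIdeal K))
    (π : Equiv.Perm (Fin 4)) {q a : MvPolynomial (Fin 4 × Fin 4) K} {k : ℕ}
    (hq : minorFour K ^ k * q ∈ principalIdeal K) (ha : a ∈ minorIdeal K) :
    q * a ∈ satIdeal (permute K π z) (principalIdeal K) := by
  have hq' := permute_mem_principalIdeal π.symm hq
  rw [map_mul, map_pow, permute_minorFour] at hq'
  obtain ⟨n, hn⟩ := h hq' (permute_mem_minorIdeal π.symm ha)
  refine ⟨n, ?_⟩
  simpa only [map_mul, map_pow, permute_permute_symm] using permute_mem_principalIdeal π hn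

theorem mul_mem_satIdeal_minorTwo {q a : MvPolynomial (Fin 4 × Fin 4) K} {k : ℕ}
    (hq : minorFour K ^ k * q ∈ principalIdeal K) (ha : a ∈ minorIdeal K) :
    q * a ∈ satIdeal (minorTwo 2 3 2 3) (principalIdeal K) := by
  refine mem_of_forall_pow_mul_mem (l := [minorTwo 0 3 1 3, minorTwo 1 3 0 3])
    (fun b hb => mem_satIdeal_of_minorTwo_mul (hb _ (by simp)) (hb _ (by simp))) ?_
  obtain ⟨n, hn⟩ := mul_mem_satIdeal_of_minorFour hq ha
  obtain ⟨m, hm⟩ := mul_mem_satIdeal_permute mul_mem_satIdeal_of_minorFour (Equiv.swap 0 1) hq ha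
  have e2 : Equiv.swap (0 : Fin 4) 1 2 = 2 := by decide
  have e3 : Equiv.swap (0 : Fin 4) 1 3 = 3 := by decide
  rw [map_mul, permute_minorTwo, permute_minorTwo, Equiv.swap_apply_left, Equiv.swap_apply_right,
    e2, e3] at hm
  simp only [List.forall_mem_cons]
  exact ⟨⟨n, n, by rwa [← mul_assoc, ← mul_pow]⟩, ⟨m, m, by rwa [← mul_assoc, ← mul_pow]⟩, by simp⟩

theorem mul_mem_principalIdeal {q a : MvPolynomial (Fin 4 × Fin 4) K} {k : ℕ}
    (hq : minorFour K ^ k * q ∈ principalIdeal K) (ha : a ∈ minorIdeal K) :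
    q * a ∈ principalIdeal K := by
  have hperm : ∀ b c : Fin 4, b ≠ c → ∃ π : Equiv.Perm (Fin 4), π 2 = b ∧ π 3 = c := by decide
  have key : ∀ b c : Fin 4, b ≠ c →
      ∃ n : ℕ, minorTwo b c c b ^ n * (q * a) ∈ principalIdeal K := fun b c hbc => by
    obtain ⟨π, rfl, rfl⟩ := hperm b c hbc
    obtain ⟨n, hn⟩ := mul_mem_satIdeal_permute mul_mem_satIdeal_minorTwo π hq ha
    refine ⟨n, ?_⟩
    rw [permute_minorTwo] at hn
    rw [show minorTwo (π 2) (π 3) (π 3) (π 2) = -(minorTwo (π 2) (π 3) (π 2) (π 3) :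
      MvPolynomial (Fin 4 × Fin 4) K) by simp [minorTwo], neg_pow, mul_assoc]
    exact Ideal.mul_mem_left _ _ hn
  refine mem_of_forall_pow_mul_mem (l := [minorTwo 0 1 1 0, minorTwo 0 2 2 0, minorTwo 0 3 3 0,
    minorTwo 1 2 2 1, minorTwo 1 3 3 1])
    (fun b hb => mem_of_forall_minorTwo_mul_mem fun t ht => hb t (by simpa using ht)) ?_
  simp only [List.forall_mem_cons]
  exact ⟨key _ _ (by decide), key _ _ (by decide), key _ _ (by decide), key _ _ (by decide),
    key _ _ (by decide), by simp⟩

theorem minorFour_mem_minorIdeal : minorFour K ∈ minorIdeal K := by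
  have h := fun a b c d e f (r : MvPolynomial (Fin 4 × Fin 4) K) =>
    Ideal.mul_mem_left _ r (minorThree_mem_minorIdeal K a b c d e f)
  exact sub_mem (add_mem (sub_mem (h _ _ _ _ _ _ _) (h _ _ _ _ _ _ _)) (h _ _ _ _ _ _ _)) (h _ _ _ _ _ _ _)

/-- The Sylvester identity for the `2`-minor on the last two rows and columns. -/
theorem minorTwo_mul_minorFour : minorTwo 2 3 2 3 * minorFour K =
    minorThree 0 2 3 0 2 3 * minorThree 1 2 3 1 2 3 -
      minorThree 0 2 3 1 2 3 * minorThree 1 2 3 0 2 3 := by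
  simp only [minorFour, minorThree, minorTwo]
  ring

theorem minorFour_mul_minorTwo_mul_eliminant_mem :
    minorFour K * (minorTwo 2 3 2 3 * eliminant K) ∈ principalIdeal K := by
  rw [show minorFour K * (minorTwo 2 3 2 3 * eliminant K) =
    minorTwo 2 3 2 3 * minorFour K * eliminant K by ring, minorTwo_mul_minorFour,
    show ∀ p p' m m' w : MvPolynomial (Fin 4 × Fin 4) K,
      (p * p' - m * m') * w = p * w * p' - m' * (m * w) by intros; ring]
  exact sub_mem (Ideal.mul_mem_left _ _ (Ideal.mem_ofList_of_mem (by simp)))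
    (Ideal.mul_mem_left _ _ minorThree_mul_eliminant_mem)

theorem minorTwo_mul_eliminant_notMem : minorTwo 2 3 2 3 * eliminant K ∉ minorIdeal K :=
  not_mem_of_eval !![0, 1, 0, 1; 1, 0, 1, 0; 1, 0, 1, 0; 0, 1, 0, 1]
    (by simp [minorTwo, minorThree]) (by simp [minorTwo, eliminant])

theorem principalIdeal_le_minorIdeal : principalIdeal K ≤ minorIdeal K :=
  Ideal.ofList_le (by simp [minorThree_mem_minorIdeal])

end

/-- For `n = 4`, the ideals `I₃` and `Q₃` are algebraically linked via `P₃`: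
`Q₃ = P₃ : I₃` and `I₃ = P₃ : Q₃`. -/
theorem detIdeal_Qideal_linked (K : Type*) [Field K] [IsAlgClosed K] :
    Qideal K 4 = Submodule.colon (prinMinorIdeal K 4 3) (detIdeal K 4 3) ∧
      detIdeal K 4 3 = Submodule.colon (prinMinorIdeal K 4 3) (Qideal K 4) := by
  rw [prinMinorIdeal_eq, detIdeal_eq]
  refine ⟨Submodule.ext fun q => ?_, Submodule.ext fun g => ?_⟩ <;> rw [Submodule.mem_colon]
  · refine ⟨fun hq a ha => ?_, fun h => (mem_Qideal K).2 ⟨1, ?_⟩⟩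
    · obtain ⟨k, hk⟩ := (mem_Qideal K).1 hq
      exact mul_mem_principalIdeal hk ha
    · rw [pow_one, mul_comm]
      exact h _ minorFour_mem_minorIdeal
  · refine ⟨fun hg q hq => ?_, fun h => ?_⟩
    · obtain ⟨k, hk⟩ := (mem_Qideal K).1 hq
      rw [smul_eq_mul, mul_comm]
      exact mul_mem_principalIdeal hk hg
    · have := h _ ((mem_Qideal K).2 ⟨1, by
        rw [pow_one]; exact minorFour_mul_minorTwo_mul_eliminant_mem⟩)
      exact (isPrime_rankTwo.mem_or_mem (principalIdeal_le_minorIdeal this)).resolve_right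
        minorTwo_mul_eliminant_notMem
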